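/- Let K be a number field, Ē a nonzero hermitian 𝒪_K-lattice, and K'/K a finite extension of degree d. Then μ_max(Ē_{𝒪_{K'}}) = d · μ_max(Ē), where Ē_{𝒪_{K'}} = E ⊗_{𝒪_K} 𝒪_{K'} with the scalar-extended metrics. -/

import Mathlib

open scoped NumberField ComplexOrder Classical

noncomputable section

/-- The hermitian pairing on complex coordinate vectors determined by the (Gram) matrix `M`:
`⟨u, v⟩ = ∑ conj(uᵢ) · Mᵢⱼ · vⱼ` (antilinear in the first variable). -/
def cForm {ι : Type} [Fintype ι] (M : Matrix ι ι ℂ) (u v : ι → ℂ) : ℂ :=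
  ∑ i, ∑ j, (starRingEnd ℂ) (u i) * M i j * v j

/-- The hermitian pairing, at the complex embedding `σ` of `K`, of two `K`-rational
coordinate vectors, for the metric with Gram matrix `M` at `σ`. -/
def eForm {K : Type} [Field K] {ι : Type} [Fintype ι] (M : Matrix ι ι ℂ)
    (σ : K →+* ℂ) (u v : ι → K) : ℂ :=
  cForm M (fun i => σ (u i)) (fun i => σ (v i))

/-- The arithmetic degree of a (finitely generated) `𝒪_K`-submodule `F` of `K^ι`, for the
hermitian metrics on `K^ι` whose Gram matrix at the complex embedding `σ` is `H σ`, with the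
induced metrics on `F`.  It is computed from a `K`-linearly independent family `x` of elements
of `F` spanning the same `K`-subspace as `F`:
`deg F = log #(F / (𝒪_K x₁ + ⋯ + 𝒪_K x_s)) - ∑_σ log ‖x₁ ∧ ⋯ ∧ x_s‖_σ`,
where `‖x₁ ∧ ⋯ ∧ x_s‖_σ` is the square root of the Gram determinant of `x` at `σ`.
(For `F` of rank one this is the usual `deg F = log #(F/𝒪_K ℓ) - ∑_v ε_v log ‖ℓ‖_v`, the sum
running over all complex embeddings; the general case agrees with `deg F = deg (det F)`,
where `det F = Λ^s F` carries the Gram-determinant metrics.) -/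
def hDeg (K : Type) [Field K] [NumberField K] {ι : Type} [Fintype ι]
    (H : (K →+* ℂ) → Matrix ι ι ℂ) (F : Submodule (𝓞 K) (ι → K)) : ℝ :=
  if h : ∃ p : (s : ℕ) × (Fin s → ι → K), 0 < p.1 ∧ (∀ a, p.2 a ∈ F) ∧
      LinearIndependent K p.2 ∧ ∀ y ∈ F, y ∈ Submodule.span K (Set.range p.2) then
    Real.log (Nat.card
        (↥F ⧸ Submodule.comap F.subtype (Submodule.span (𝓞 K) (Set.range h.choose.2))))
      - ∑ᶠ σ : K →+* ℂ, Real.log (Real.sqrt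
          ((Matrix.of fun a b => eForm (H σ) σ (h.choose.2 a) (h.choose.2 b)).det.re))
  else 0

/-- The rank of an `𝒪_K`-submodule `F` of `K^ι`: the dimension of the `K`-subspace
it spans. -/
def hRank (K : Type) [Field K] [NumberField K] {ι : Type} [Fintype ι]
    (F : Submodule (𝓞 K) (ι → K)) : ℕ :=
  Module.finrank K ↥(Submodule.span K (F : Set (ι → K)))

/-- The slope of a nonzero `𝒪_K`-submodule of `K^ι` with the induced metrics:
degree divided by rank. -/
def hMu (K : Type) [Field K] [NumberField K] {ι : Type} [Fintype ι]
    (H : (K →+* ℂ) → Matrix ι ι ℂ) (F : Submodule (𝓞 K) (ι → K)) : ℝ :=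
  hDeg K H F / hRank K F

/-- The maximal slope `μ_max` of the hermitian `𝒪_K`-lattice `E ⊆ K^ι`: the supremum of the
slopes of its nonzero `𝒪_K`-submodules (of any rank), with the induced metrics. -/
def hMuMax (K : Type) [Field K] [NumberField K] {ι : Type} [Fintype ι]
    (H : (K →+* ℂ) → Matrix ι ι ℂ) (E : Submodule (𝓞 K) (ι → K)) : ℝ :=
  sSup { m : ℝ | ∃ F : Submodule (𝓞 K) (ι → K), F ≠ ⊥ ∧ F ≤ E ∧ m = hMu K H F }

/-- The compatibility of the family of Gram matrices `H` with complex conjugation: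
the metric at the conjugate embedding is the conjugate metric (so that the data of `H`
amounts to a euclidean/hermitian metric at each archimedean place of `K`). -/
def ConjCompatible (K : Type) [Field K] {ι : Type} [Fintype ι]
    (H : (K →+* ℂ) → Matrix ι ι ℂ) : Prop :=
  ∀ σ : K →+* ℂ, H ((starRingEnd ℂ).comp σ) = (H σ).map (starRingEnd ℂ)

/-- The arithmetic degree of a nonzero rank-one hermitian `𝒪_K'`-lattice, presented as a
nonzero finitely generated `𝒪_{K'}`-submodule `L` of `K'` whose metric at the complex
embedding `σ` is `‖y‖_σ² = g σ · |σ(y)|²`: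
`deg L = log #(L/𝒪_{K'} ℓ) - ∑_σ log ‖ℓ‖_σ` for a nonzero `ℓ ∈ L`. -/
def degLine (K' : Type) [Field K'] [NumberField K']
    (L : Submodule (𝓞 K') K') (g : (K' →+* ℂ) → ℝ) : ℝ :=
  if h : ∃ x : K', x ∈ L ∧ x ≠ 0 then
    Real.log (Nat.card
        (↥L ⧸ Submodule.comap L.subtype (Submodule.span (𝓞 K') {h.choose})))
      - ∑ᶠ σ : K' →+* ℂ, Real.log (Real.sqrt (g σ * Complex.normSq (σ h.choose)))
  else 0

/-- The quotient metric induced at the embedding `σ` on a rank-one quotient of the hermitian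
lattice `(K'^ι, H')` via the `K'`-linear surjection `ψ : K'^ι → K'`:
`‖1‖² = inf { ⟨e, e⟩_{H' σ} | ψ_σ(e) = 1 }` (infimum over the fibre of `1` in `ℂ^ι`). -/
def quotMetric {K' : Type} [Field K'] {ι : Type} [Fintype ι] [DecidableEq ι]
    (H' : (K' →+* ℂ) → Matrix ι ι ℂ) (ψ : (ι → K') →ₗ[K'] K') (σ : K' →+* ℂ) : ℝ :=
  sInf { t : ℝ | ∃ e : ι → ℂ, (∑ i, σ (ψ (Pi.single i 1)) * e i) = 1 ∧
    t = (cForm (H' σ) e e).re }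

/-- Base change of an `𝒪_K`-lattice `E ⊆ K^ι` to the ring of integers of a finite
extension `K'` of `K`: the `𝒪_{K'}`-span of the image of `E` in `K'^ι`. -/
def baseChange (K K' : Type) [Field K] [NumberField K] [Field K'] [NumberField K']
    [Algebra K K'] {ι : Type} [Fintype ι] (E : Submodule (𝓞 K) (ι → K)) :
    Submodule (𝓞 K') (ι → K') :=
  Submodule.span (𝓞 K') ((fun v i => algebraMap K K' (v i)) '' (E : Set (ι → K)))

/-- The metrics on the base change to `K'` of a hermitian lattice over `K` with metrics `H`:
the Gram matrix at an embedding `σ'` of `K'` is the Gram matrix of `H` at the induced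
embedding of `K`. -/
def baseChangeMetric (K K' : Type) [Field K] [Field K'] [Algebra K K'] {ι : Type}
    (H : (K →+* ℂ) → Matrix ι ι ℂ) : (K' →+* ℂ) → Matrix ι ι ℂ :=
  fun σ' => H (σ'.comp (algebraMap K K'))

/-- A hermitian `𝒪_K`-lattice `E ⊆ K^ι` (with metrics `H`) is nef if for every finite
extension `K'/K`, every rank-one quotient of `E ⊗_{𝒪_K} 𝒪_{K'}`, with the quotient metrics,
has nonnegative arithmetic degree.  A rank-one quotient is the image of `E ⊗ 𝒪_{K'}` under a
`K'`-linear form `ψ` on `K'^ι` (every rank-one quotient of the full lattice `E ⊗ 𝒪_{K'}`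
arises this way, with the quotient metrics given by `quotMetric`). -/
def IsNef (K : Type) [Field K] [NumberField K] {ι : Type} [Fintype ι] [DecidableEq ι]
    (H : (K →+* ℂ) → Matrix ι ι ℂ) (E : Submodule (𝓞 K) (ι → K)) : Prop :=
  ∀ (K' : Type) [Field K'] [NumberField K'] [Algebra K K'],
    ∀ ψ : (ι → K') →ₗ[K'] K',
      Submodule.map (ψ.restrictScalars (𝓞 K')) (baseChange K K' E) ≠ ⊥ →
      0 ≤ degLine K' (Submodule.map (ψ.restrictScalars (𝓞 K')) (baseChange K K' E))
            (quotMetric (baseChangeMetric K K' H) ψ)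

end

noncomputable section

open Matrix

theorem AddSubgroup.relIndex_mul_relIndex_of_le {A : Type*} [AddCommGroup A]
    {F G X Y : AddSubgroup A} (hX : X ≤ F) (hY : Y ≤ G) :
    X.relIndex F * Y.relIndex G = (X ⊔ Y).relIndex (F ⊔ G) * (X ⊓ Y).relIndex (F ⊓ G) := by
  have h1 : (X ⊔ F ⊓ Y).relIndex F = (X ⊔ Y).relIndex (F ⊔ Y) := by
    have e : F ⊓ (X ⊔ Y) = X ⊔ F ⊓ Y := by
      rw [inf_comm, sup_inf_assoc_of_le _ hX, inf_comm]
    have e2 : F ⊔ Y = F ⊔ (X ⊔ Y) := by rw [← sup_assoc, sup_eq_left.mpr hX]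
    rw [e2, AddSubgroup.relIndex_sup_right, ← e, inf_comm, AddSubgroup.inf_relIndex_right]
  have h2 : (F ⊔ Y).relIndex (F ⊔ G) = (F ⊓ G ⊔ Y).relIndex G := by
    have e : G ⊓ (F ⊔ Y) = F ⊓ G ⊔ Y := by
      rw [inf_comm, sup_comm F, sup_inf_assoc_of_le _ hY, sup_comm]
    have e2 : F ⊔ G = G ⊔ (F ⊔ Y) := by
      rw [sup_comm F Y, ← sup_assoc, sup_eq_left.mpr hY, sup_comm]
    rw [e2, AddSubgroup.relIndex_sup_right, ← e, inf_comm, AddSubgroup.inf_relIndex_right]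
  have h3 : (X ⊔ Y).relIndex (F ⊔ Y) * (F ⊔ Y).relIndex (F ⊔ G) = (X ⊔ Y).relIndex (F ⊔ G) :=
    AddSubgroup.relIndex_mul_relIndex _ _ _ (sup_le_sup_right hX _) (sup_le_sup_left hY _)
  have h4 : X.relIndex (X ⊔ F ⊓ Y) * (X ⊔ F ⊓ Y).relIndex F = X.relIndex F :=
    AddSubgroup.relIndex_mul_relIndex _ _ _ le_sup_left (sup_le hX inf_le_left)
  have h5 : Y.relIndex (F ⊓ G ⊔ Y) * (F ⊓ G ⊔ Y).relIndex G = Y.relIndex G :=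
    AddSubgroup.relIndex_mul_relIndex _ _ _ le_sup_right (sup_le inf_le_right hY)
  have h6 : X.relIndex (X ⊔ F ⊓ Y) = (X ⊓ Y).relIndex (F ⊓ Y) := by
    rw [AddSubgroup.relIndex_sup_left, ← AddSubgroup.inf_relIndex_right]
    congr 1
    rw [← inf_assoc, inf_eq_left.mpr hX]
  have h7 : Y.relIndex (F ⊓ G ⊔ Y) = (F ⊓ Y).relIndex (F ⊓ G) := by
    rw [AddSubgroup.relIndex_sup_right, ← AddSubgroup.inf_relIndex_right]
    congr 1
    rw [inf_comm, inf_assoc, inf_eq_right.mpr hY]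
  have h8 : (X ⊓ Y).relIndex (F ⊓ Y) * (F ⊓ Y).relIndex (F ⊓ G) = (X ⊓ Y).relIndex (F ⊓ G) :=
    AddSubgroup.relIndex_mul_relIndex _ _ _ (inf_le_inf_right _ hX) (inf_le_inf_left _ hY)
  rw [← h4, ← h5, ← h3, ← h8, h1, h2, h6, h7]
  ring

theorem LinearMap.index_range_eq_natAbs_norm_det {R M : Type*} [CommRing R] [IsDomain R]
    [Module.Free ℤ R] [Module.Finite ℤ R] [AddCommGroup M] [Module R M] [Module.Free R M]
    [Module.Finite R M] (f : M →ₗ[R] M) (hf : Function.Injective f) :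
    (LinearMap.range f).toAddSubgroup.index = (Algebra.norm ℤ (LinearMap.det f)).natAbs := by
  have : Module.Free ℤ M := Module.Free.trans (S := R)
  have : Module.Finite ℤ M := Module.Finite.trans R M
  rw [← LinearMap.det_restrictScalars (R := ℤ)]
  have h := Submodule.natAbs_det_equiv (LinearMap.range (f.restrictScalars ℤ))
    (LinearEquiv.ofInjective (f.restrictScalars ℤ) hf)
  have e : (LinearMap.range (f.restrictScalars ℤ)).subtype ∘ₗ AddMonoidHom.toIntLinearMap
    ((LinearEquiv.ofInjective (f.restrictScalars ℤ) hf :  M ≃ₗ[ℤ] _) : M →+ _) =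
      f.restrictScalars ℤ := by
    ext x; rfl
  rw [e] at h
  rw [h]
  rfl

namespace Matrix

theorem PosSemidef.one_le_det_one_add {n : Type*} [Fintype n] {P : Matrix n n ℂ}
    (hP : P.PosSemidef) : 1 ≤ (1 + P).det := by
  have h : (1 + P).det = ∏ i, (1 + (hP.1.eigenvalues i : ℂ)) := by
    conv_lhs => rw [hP.1.spectral_theorem]
    rw [← map_one (Unitary.conjStarAlgAut ℂ (Matrix n n ℂ) hP.1.eigenvectorUnitary), ← map_add,
      Unitary.conjStarAlgAut_apply, det_mul_right_comm]
    rw [← Unitary.coe_star, Unitary.coe_mul_star_self, one_mul, ← diagonal_one, diagonal_add,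
      det_diagonal]
    rfl
  rw [h]
  have h2 : (1 : ℝ) ≤ ∏ i, (1 + hP.1.eigenvalues i) :=
    Finset.one_le_prod fun i _ => le_add_of_nonneg_right (hP.eigenvalues_nonneg i)
  exact_mod_cast h2

theorem PosDef.det_le_det_add {n : Type*} [Fintype n] {A C : Matrix n n ℂ}
    (hA : A.PosDef) (hC : C.PosSemidef) : A.det ≤ (A + C).det := by
  obtain ⟨B, hB, hAB⟩ : ∃ B : Matrix n n ℂ, IsUnit B ∧ A = Bᴴ * B := by
    open scoped MatrixOrder Matrix.Norms.L2Operator in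
    exact CStarAlgebra.isStrictlyPositive_iff_eq_star_mul_self.mp hA.isStrictlyPositive
  have hu : IsUnit B.det := (isUnit_iff_isUnit_det B).mp hB
  have hu' : IsUnit Bᴴ.det := by rw [det_conjTranspose]; exact hu.star
  have hP := hC.conjTranspose_mul_mul_same B⁻¹
  have e : A + C = Bᴴ * (1 + (B⁻¹)ᴴ * C * B⁻¹) * B := by
    rw [mul_add, add_mul, mul_one, ← hAB, conjTranspose_nonsing_inv]
    simp only [← mul_assoc]
    rw [mul_nonsing_inv _ hu', one_mul, mul_assoc, nonsing_inv_mul _ hu, mul_one]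
  have e2 : (A + C).det = A.det * (1 + (B⁻¹)ᴴ * C * B⁻¹).det := by
    rw [e, hAB]; simp only [det_mul]; ring
  rw [e2]
  exact le_mul_of_one_le_right hA.det_pos.le hP.one_le_det_one_add

theorem PosDef.det_fromBlocks_le {m n : Type*} [Fintype m] [Fintype n] {A : Matrix m m ℂ}
    {B : Matrix m n ℂ} {D : Matrix n n ℂ} (h : (fromBlocks A B Bᴴ D).PosDef) :
    (fromBlocks A B Bᴴ D).det ≤ A.det * D.det := by
  have hA : A.PosDef := h.submatrix (e := Sum.inl) Sum.inl_injective
  let := hA.isUnit.invertible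
  have hS := (hA.fromBlocks₁₁ B D).mp h.posSemidef
  have hdet := det_fromBlocks₁₁ A B Bᴴ D
  rw [invOf_eq_nonsing_inv] at hdet
  have hS' : (D - Bᴴ * A⁻¹ * B).PosDef := by
    rw [hS.posDef_iff_det_ne_zero]
    intro h0
    rw [h0, mul_zero] at hdet
    exact h.det_pos.ne' hdet
  rw [hdet]
  refine mul_le_mul_of_nonneg_left ?_ hA.det_pos.le
  have := hS'.det_le_det_add (hA.inv.posSemidef.conjTranspose_mul_mul_same B)
  rwa [sub_add_cancel] at this

/-- Koteljanskii's inequality. -/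
theorem PosDef.det_mul_det_le {p q r : Type} [Fintype p] [Fintype q] [Fintype r]
    {N : Matrix (p ⊕ (q ⊕ r)) (p ⊕ (q ⊕ r)) ℂ} (hN : N.PosDef) :
    N.det * (N.submatrix Sum.inl Sum.inl).det ≤
      (N.submatrix (Sum.map id Sum.inl) (Sum.map id Sum.inl) : Matrix (p ⊕ q) (p ⊕ q) ℂ).det *
      (N.submatrix (Sum.map id Sum.inr) (Sum.map id Sum.inr) : Matrix (p ⊕ r) (p ⊕ r) ℂ).det := by
  obtain ⟨A, B, D, rfl⟩ : ∃ A B D, N = fromBlocks A B Bᴴ D := by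
    refine ⟨N.toBlocks₁₁, N.toBlocks₁₂, N.toBlocks₂₂, ?_⟩
    rw [toBlocks₁₂, ← hN.1]
    ext (i | i) (j | j) <;> simp [toBlocks₁₁, toBlocks₂₂, hN.1.apply] 
  have hA : A.PosDef := hN.submatrix (e := Sum.inl) Sum.inl_injective
  let := hA.isUnit.invertible
  have hdet := det_fromBlocks₁₁ A B Bᴴ D
  rw [invOf_eq_nonsing_inv] at hdet
  have hS := (hA.fromBlocks₁₁ B D).mp hN.posSemidef
  set S := D - Bᴴ * A⁻¹ * B with hSdef
  have hS' : S.PosDef := by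
    rw [hS.posDef_iff_det_ne_zero]
    intro h0
    rw [h0, mul_zero] at hdet
    exact hN.det_pos.ne' hdet
  have key : ∀ {t : Type _} [Fintype t] (f : t → q ⊕ r),
      ((fromBlocks A B Bᴴ D).submatrix (Sum.map id f) (Sum.map id f)).det =
        A.det * (S.submatrix f f).det := by
    intro t _ f
    have : (fromBlocks A B Bᴴ D).submatrix (Sum.map id f) (Sum.map id f) =
      fromBlocks A (B.submatrix id f) (Bᴴ.submatrix f id) (D.submatrix f f) := by
      ext (i | i) (j | j) <;> rfl
    rw [this, det_fromBlocks₁₁, invOf_eq_nonsing_inv]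
    congr 2
  have hF : S.det ≤ (S.submatrix Sum.inl Sum.inl).det * (S.submatrix Sum.inr Sum.inr).det := by
    have e : S = fromBlocks S.toBlocks₁₁ S.toBlocks₁₂ S.toBlocks₁₂ᴴ S.toBlocks₂₂ := by
      rw [toBlocks₁₂, ← hS'.1]
      ext (i | i) (j | j) <;> simp [toBlocks₁₁, toBlocks₂₂, hS'.1.apply] 
    rw [e] at hS'
    have := hS'.det_fromBlocks_le
    rw [← e] at this
    exact this
  rw [key Sum.inl, key Sum.inr, hdet]
  have e1 : (fromBlocks A B Bᴴ D).submatrix Sum.inl Sum.inl = A := by ext i j; rfl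
  rw [e1]
  have hA0 := hA.det_pos.le
  calc A.det * S.det * A.det = A.det * A.det * S.det := by ring
    _ ≤ A.det * A.det * _ := mul_le_mul_of_nonneg_left hF (mul_nonneg hA0 hA0)
    _ = _ := by ring

end Matrix

section Gram

variable {K ι α β : Type} [Field K] [Fintype ι]

/-- The Gram determinant of the family `x` at the embedding `σ`. -/
def gramDet (M : Matrix ι ι ℂ) (σ : K →+* ℂ) {α : Type} [Fintype α] (x : α → ι → K) : ℝ :=
  (Matrix.of fun a b => eForm M σ (x a) (x b)).det.re

theorem eForm_matrix_eq [Fintype α] (M : Matrix ι ι ℂ) (σ : K →+* ℂ) (x : α → ι → K) :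
    (Matrix.of fun a b => eForm M σ (x a) (x b)) =
      (Matrix.of fun i a => σ (x a i))ᴴ * M * Matrix.of fun i a => σ (x a i) := by
  ext a b
  simp only [Matrix.of_apply, eForm, cForm, Matrix.mul_apply, Matrix.conjTranspose_apply,
    Finset.sum_mul]
  rw [Finset.sum_comm]
  rfl

theorem LinearIndependent.exists_mul_eq_one [Fintype α] {x : α → ι → K}
    (hx : LinearIndependent K x) :
    ∃ B : Matrix α ι K, B * Matrix.of (fun i a => x a i) = 1 := by
  have hinj : Function.Injective (Matrix.of (fun i a => x a i) : Matrix ι α K).mulVec :=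
    Matrix.mulVec_injective_iff.mpr hx
  obtain ⟨g, hg⟩ := LinearMap.exists_leftInverse_of_injective
    (Matrix.toLin' (Matrix.of (fun i a => x a i) : Matrix ι α K))
    (LinearMap.ker_eq_bot.mpr hinj)
  refine ⟨LinearMap.toMatrix' g, ?_⟩
  rw [← LinearMap.toMatrix'_toLin' (Matrix.of fun i a => x a i), ← LinearMap.toMatrix'_comp, hg,
    LinearMap.toMatrix'_id]

theorem posDef_gram [Fintype α] {M : Matrix ι ι ℂ} (hM : M.PosDef) (σ : K →+* ℂ) {x : α → ι → K}
    (hx : LinearIndependent K x) : (Matrix.of fun a b => eForm M σ (x a) (x b)).PosDef := by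
  rw [eForm_matrix_eq]
  refine hM.conjTranspose_mul_mul_same ?_
  obtain ⟨B, hB⟩ := hx.exists_mul_eq_one
  have h : B.map σ * (Matrix.of fun i a => σ (x a i)) = 1 := by
    have := congrArg (fun X : Matrix α α K => X.map σ) hB
    simp only [Matrix.map_mul] at this
    rw [Matrix.map_one _ (map_zero σ) (map_one σ)] at this
    exact this
  intro u v huv
  have := congrArg (B.map σ).mulVec huv
  simpa only [Matrix.mulVec_mulVec, h, Matrix.one_mulVec] using this

theorem gramDet_pos [Fintype α] {M : Matrix ι ι ℂ} (hM : M.PosDef) (σ : K →+* ℂ) {x : α → ι → K}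
    (hx : LinearIndependent K x) : 0 < gramDet M σ x :=
  (Complex.pos_iff.mp (posDef_gram hM σ hx).det_pos).1

theorem ofReal_gramDet [Fintype α] {M : Matrix ι ι ℂ} (hM : M.PosDef) (σ : K →+* ℂ)
    {x : α → ι → K} (hx : LinearIndependent K x) :
    (gramDet M σ x : ℂ) = (Matrix.of fun a b => eForm M σ (x a) (x b)).det :=
  Complex.ext rfl (Complex.pos_iff.mp (posDef_gram hM σ hx).det_pos).2

theorem gramDet_reindex [Fintype α] [Fintype β] (M : Matrix ι ι ℂ) (σ : K →+* ℂ) (x : α → ι → K)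
    (e : β ≃ α) : gramDet M σ (x ∘ e) = gramDet M σ x := by
  unfold gramDet
  rw [← Matrix.det_submatrix_equiv_self e]
  rfl

theorem gramDet_smul_sum [Fintype α] (M : Matrix ι ι ℂ) (σ : K →+* ℂ)
    (x : α → ι → K) (A : Matrix α α K) :
    gramDet M σ (fun b => ∑ a, A a b • x a) = Complex.normSq (σ A.det) * gramDet M σ x := by
  unfold gramDet
  have e : (Matrix.of fun i b => σ ((∑ a, A a b • x a) i) : Matrix ι α ℂ) =
      (Matrix.of fun i a => σ (x a i)) * A.map σ := by
    ext i b
    simp [Matrix.mul_apply, mul_comm]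
  rw [eForm_matrix_eq, eForm_matrix_eq, e, Matrix.conjTranspose_mul]
  have e2 : (A.map σ)ᴴ * (Matrix.of fun i a => σ (x a i))ᴴ * M *
      ((Matrix.of fun i a => σ (x a i)) * A.map σ) =
      (A.map σ)ᴴ * ((Matrix.of fun i a => σ (x a i))ᴴ * M *
      (Matrix.of fun i a => σ (x a i))) * A.map σ := by
    simp only [Matrix.mul_assoc]
  rw [e2, Matrix.det_mul, Matrix.det_mul, Matrix.det_conjTranspose, ← RingHom.mapMatrix_apply,
    ← RingHom.map_det, mul_right_comm]
  have e3 : star (σ A.det) * σ A.det = (Complex.normSq (σ A.det) : ℂ) := by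
    rw [Complex.normSq_eq_conj_mul_self]; rfl
  rw [e3, Complex.re_ofReal_mul]

theorem gramDet_mul_le {p q r : Type} [Fintype p] [Fintype q] [Fintype r]
    {M : Matrix ι ι ℂ} (hM : M.PosDef) (σ : K →+* ℂ) (x : p ⊕ (q ⊕ r) → ι → K)
    (hx : LinearIndependent K x) :
    gramDet M σ x * gramDet M σ (x ∘ Sum.inl) ≤
      gramDet M σ (x ∘ Sum.map id Sum.inl : p ⊕ q → ι → K) *
        gramDet M σ (x ∘ Sum.map id Sum.inr : p ⊕ r → ι → K) := by
  have h := (posDef_gram hM σ hx).det_mul_det_le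
  have h1 := ofReal_gramDet hM σ hx
  have h2 := ofReal_gramDet hM σ (hx.comp Sum.inl Sum.inl_injective)
  have h3 := ofReal_gramDet hM σ (hx.comp (Sum.map id Sum.inl : p ⊕ q → _)
    (Sum.map_injective.mpr ⟨Function.injective_id, Sum.inl_injective⟩))
  have h4 := ofReal_gramDet hM σ (hx.comp (Sum.map id Sum.inr : p ⊕ r → _)
    (Sum.map_injective.mpr ⟨Function.injective_id, Sum.inr_injective⟩))
  have : ((gramDet M σ x * gramDet M σ (x ∘ Sum.inl) : ℝ) : ℂ) ≤
      ((gramDet M σ (x ∘ Sum.map id Sum.inl : p ⊕ q → ι → K) *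
        gramDet M σ (x ∘ Sum.map id Sum.inr : p ⊕ r → ι → K) : ℝ) : ℂ) := by
    push_cast
    rw [h1, h2, h3, h4]
    convert h <;> rfl
  exact_mod_cast this

end Gram

section Lattice

variable {K ι : Type} [Field K] [NumberField K]

theorem NumberField.exists_int_smul_mem_of_mem_span {A : Submodule (𝓞 K) (ι → K)} {y : ι → K}
    (hy : y ∈ Submodule.span K (A : Set (ι → K))) : ∃ n : ℤ, n ≠ 0 ∧ n • y ∈ A := by
  induction hy using Submodule.span_induction with
  | mem x h => exact ⟨1, one_ne_zero, by simpa using h⟩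
  | zero => exact ⟨1, one_ne_zero, by simp⟩
  | add x y _ _ hx hy =>
    obtain ⟨m, hm, hx⟩ := hx
    obtain ⟨n, hn, hy⟩ := hy
    refine ⟨m * n, mul_ne_zero hm hn, ?_⟩
    rw [smul_add]
    refine A.add_mem ?_ ?_
    · rw [mul_comm, mul_smul]
      exact zsmul_mem hx n
    · rw [mul_smul]
      exact zsmul_mem hy m
  | smul c x _ hx =>
    obtain ⟨m, hm, hx⟩ := hx
    obtain ⟨n, hn, hc⟩ := ((IsFractionRing.isAlgebraic_iff ℤ ℚ K).mpr
      (Algebra.IsAlgebraic.isAlgebraic c)).exists_integral_multiple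
    refine ⟨n * m, mul_ne_zero hn hm, ?_⟩
    have : (n * m) • c • x = (⟨n • c, hc⟩ : 𝓞 K) • (m • x) := by
      ext i
      simp [Algebra.smul_def]
      ring
    rw [this]
    exact A.smul_mem _ hx

theorem relIndex_ne_zero_of_torsion {A B : Submodule (𝓞 K) (ι → K)} (hB : B.FG)
    (h : ∀ b ∈ B, ∃ n : ℤ, n ≠ 0 ∧ n • b ∈ A) :
    A.toAddSubgroup.relIndex B.toAddSubgroup ≠ 0 := by
  have : Module.Finite (𝓞 K) B := Module.Finite.iff_fg.mpr hB
  have : Module.Finite ℤ B := Module.Finite.trans (𝓞 K) B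
  have : Finite (B ⧸ A.comap B.subtype) := by
    have : Module.Finite ℤ (B ⧸ A.comap B.subtype) := Module.Finite.trans (𝓞 K) _
    refine Module.finite_of_fg_torsion _ ?_
    intro q
    obtain ⟨b, rfl⟩ := Submodule.mkQ_surjective (A.comap B.subtype) q
    obtain ⟨n, hn, hb⟩ := h b b.2
    refine ⟨⟨n, mem_nonZeroDivisors_of_ne_zero hn⟩, ?_⟩
    exact (Submodule.Quotient.mk_eq_zero (A.comap B.subtype) (x := n • b)).mpr hb
  exact AddSubgroup.index_ne_zero_iff_finite.mpr this

theorem relIndex_span_smul_sum {α : Type} [Fintype α] {x : α → ι → K} (hx : LinearIndependent K x)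
    (A : Matrix α α (𝓞 K)) (hA : A.det ≠ 0) :
    (Submodule.span (𝓞 K) (Set.range fun b => ∑ a, A a b • x a)).toAddSubgroup.relIndex
      (Submodule.span (𝓞 K) (Set.range x)).toAddSubgroup = (Algebra.norm ℤ A.det).natAbs := by
  set φ := Fintype.linearCombination (𝓞 K) x with hφ
  have hφi : Function.Injective φ := by
    have h := hx.restrict_scalars' (𝓞 K)
    exact h.fintypeLinearCombination_injective
  have hAi : Function.Injective (Matrix.toLin' A) := Matrix.mulVec_injective_of_det_ne_zero hA
  have h1 : Submodule.span (𝓞 K) (Set.range x) = Submodule.map φ ⊤ := by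
    rw [Submodule.map_top, Fintype.range_linearCombination]
  have h2 : Submodule.span (𝓞 K) (Set.range fun b => ∑ a, A a b • x a) =
      Submodule.map φ (LinearMap.range (Matrix.toLin' A)) := by
    rw [Matrix.range_toLin', Submodule.map_span, ← Set.range_comp]
    rfl
  rw [h1, h2, ← LinearMap.det_toLin' A, ← LinearMap.index_range_eq_natAbs_norm_det _ hAi]
  have := AddSubgroup.relIndex_map_map_of_injective
    (LinearMap.range (Matrix.toLin' A)).toAddSubgroup ⊤ (f := φ.toAddMonoidHom) hφi
  rw [AddSubgroup.relIndex_top_right] at this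
  exact this

end Lattice

section Degree

variable {K ι α β : Type} [Field K]

theorem NumberField.sum_log_norm_embeddings [NumberField K] {d : 𝓞 K} (hd : d ≠ 0) :
    ∑ σ : K →+* ℂ, Real.log ‖σ d‖ = Real.log (Algebra.norm ℤ d).natAbs := by
  rw [← Real.log_prod (fun σ _ => by simpa using hd)]
  congr 1
  have h := Algebra.norm_eq_prod_embeddings ℚ ℂ (d : K)
  rw [← Fintype.prod_equiv (RingHom.equivRatAlgHom K ℂ) (fun σ : K →+* ℂ => σ d) _
    (fun _ => rfl)] at h
  rw [← norm_prod, ← h, ← Algebra.coe_norm_int]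
  simp [Nat.cast_natAbs]

/-- The family `x` is a `K`-basis, consisting of elements of `F`, of the `K`-subspace spanned by `F`. -/
structure IsFrame (F : Submodule (𝓞 K) (ι → K)) (x : α → ι → K) : Prop where
  mem : ∀ a, x a ∈ F
  linearIndependent : LinearIndependent K x
  mem_span : ∀ y ∈ F, y ∈ Submodule.span K (Set.range x)

/-- The arithmetic degree of `F` computed with the frame `x`. -/
def frameDeg [NumberField K] [Fintype ι] [Fintype α] (H : (K →+* ℂ) → Matrix ι ι ℂ)
    (F : Submodule (𝓞 K) (ι → K)) (x : α → ι → K) : ℝ :=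
  Real.log ((Submodule.span (𝓞 K) (Set.range x)).toAddSubgroup.relIndex F.toAddSubgroup)
    - ∑ σ : K →+* ℂ, Real.log (Real.sqrt (gramDet (H σ) σ x))

namespace IsFrame

variable {F G : Submodule (𝓞 K) (ι → K)} {x : α → ι → K} {y : β → ι → K}

theorem span_le (hx : IsFrame F x) : Submodule.span (𝓞 K) (Set.range x) ≤ F :=
  Submodule.span_le.mpr (Set.range_subset_iff.mpr hx.mem)

theorem span_eq (hx : IsFrame F x) :
    Submodule.span K (F : Set (ι → K)) = Submodule.span K (Set.range x) :=
  le_antisymm (Submodule.span_le.mpr hx.mem_span)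
    (Submodule.span_mono (Set.range_subset_iff.mpr hx.mem))

theorem of_span_eq (h : ∀ a, x a ∈ F) (hx : LinearIndependent K x)
    (hs : Submodule.span K (F : Set (ι → K)) = Submodule.span K (Set.range x)) : IsFrame F x :=
  ⟨h, hx, fun _ hy => hs ▸ Submodule.subset_span hy⟩

theorem hRank_eq [NumberField K] [Fintype ι] [Fintype α] (hx : IsFrame F x) :
    hRank K F = Fintype.card α := by
  rw [hRank, hx.span_eq]
  exact finrank_span_eq_card hx.linearIndependent

theorem comp_equiv (hx : IsFrame F x) (e : β ≃ α) : IsFrame F (x ∘ e) :=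
  ⟨fun _ => hx.mem _, hx.linearIndependent.comp e e.injective, by
    rw [e.surjective.range_comp]; exact hx.mem_span⟩

theorem exists_int_smul_mem_span [NumberField K] (hx : IsFrame F x) {v : ι → K} (hv : v ∈ F) :
    ∃ n : ℤ, n ≠ 0 ∧ n • v ∈ Submodule.span (𝓞 K) (Set.range x) :=
  NumberField.exists_int_smul_mem_of_mem_span
    (Submodule.span_mono Submodule.subset_span (hx.mem_span v hv))

theorem relIndex_ne_zero [NumberField K] (hF : F.FG) (hx : IsFrame F x) :
    (Submodule.span (𝓞 K) (Set.range x)).toAddSubgroup.relIndex F.toAddSubgroup ≠ 0 :=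
  relIndex_ne_zero_of_torsion hF fun _ hb => hx.exists_int_smul_mem_span hb

end IsFrame

variable [NumberField K] [Fintype ι]

theorem exists_isFrame (F : Submodule (𝓞 K) (ι → K)) :
    ∃ x : Fin (hRank K F) → ι → K, IsFrame F x := by
  obtain ⟨f, hf, hs, hl⟩ := Submodule.exists_fun_fin_finrank_span_eq K (F : Set (ι → K))
  exact ⟨f, .of_span_eq hf hl hs.symm⟩

variable [Fintype α] [Fintype β]

theorem frameDeg_comp_equiv (H : (K →+* ℂ) → Matrix ι ι ℂ) (F : Submodule (𝓞 K) (ι → K))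
    (x : α → ι → K) (e : β ≃ α) : frameDeg H F (x ∘ e) = frameDeg H F x := by
  simp only [frameDeg, gramDet_reindex, e.surjective.range_comp]

variable {H : (K →+* ℂ) → Matrix ι ι ℂ} {F G : Submodule (𝓞 K) (ι → K)}

theorem frameDeg_smul_sum (hH : ∀ σ, (H σ).PosDef) (hF : F.FG) {x : α → ι → K}
    (hx : IsFrame F x) (A : Matrix α α (𝓞 K)) (hA : A.det ≠ 0) :
    frameDeg H F (fun b => ∑ a, A a b • x a) = frameDeg H F x := by
  have hle : Submodule.span (𝓞 K) (Set.range fun b => ∑ a, A a b • x a) ≤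
      Submodule.span (𝓞 K) (Set.range x) := by
    rw [Submodule.span_le]
    rintro _ ⟨b, rfl⟩
    exact Submodule.sum_mem _ fun a _ =>
      Submodule.smul_mem _ _ (Submodule.subset_span ⟨a, rfl⟩)
  have h1 := AddSubgroup.relIndex_mul_relIndex _ _ _
    (Submodule.toAddSubgroup_mono hle) (Submodule.toAddSubgroup_mono hx.span_le)
  rw [relIndex_span_smul_sum hx.linearIndependent A hA] at h1
  have hn : ((Algebra.norm ℤ A.det).natAbs : ℝ) ≠ 0 := by
    simpa [Algebra.norm_eq_zero_iff] using hA
  have h2 : ∀ σ : K →+* ℂ, Real.log (Real.sqrt (gramDet (H σ) σ fun b => ∑ a, A a b • x a)) =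
      Real.log ‖σ A.det‖ + Real.log (Real.sqrt (gramDet (H σ) σ x)) := by
    intro σ
    have hg := gramDet_pos (hH σ) σ hx.linearIndependent
    have h3 := gramDet_smul_sum (H σ) σ x (A.map (algebraMap (𝓞 K) K))
    have h4 : (A.map (algebraMap (𝓞 K) K)).det = algebraMap (𝓞 K) K A.det :=
      ((algebraMap (𝓞 K) K).map_det A).symm
    rw [h4] at h3
    have h5 : (fun b => ∑ a, A a b • x a) =
      fun b => ∑ a, A.map (algebraMap (𝓞 K) K) a b • x a := rfl
    rw [h5, h3, Real.sqrt_mul (Complex.normSq_nonneg _), Complex.normSq_eq_norm_sq,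
      Real.sqrt_sq (norm_nonneg _), Real.log_mul]
    · rw [norm_ne_zero_iff, map_ne_zero]
      exact NumberField.RingOfIntegers.coe_ne_zero_iff.mpr hA
    · exact (Real.sqrt_pos.mpr hg).ne'
  rw [frameDeg, frameDeg, Finset.sum_congr rfl fun σ _ => h2 σ, Finset.sum_add_distrib,
    NumberField.sum_log_norm_embeddings hA, ← h1, Nat.cast_mul, Real.log_mul hn
    (by exact_mod_cast hx.relIndex_ne_zero hF)]
  ring

theorem frameDeg_eq_of_mem_span (hH : ∀ σ, (H σ).PosDef) (hF : F.FG) {x y : α → ι → K}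
    (hx : IsFrame F x) (hy : LinearIndependent K y)
    (h : ∀ a, y a ∈ Submodule.span (𝓞 K) (Set.range x)) : frameDeg H F y = frameDeg H F x := by
  have h1 : ∀ b, ∃ c : α → 𝓞 K, ∑ a, c a • x a = y b := fun b =>
    (Submodule.mem_span_range_iff_exists_fun (𝓞 K)).mp (h b)
  choose c hc using h1
  have hyc : y = fun b => ∑ a, (Matrix.of fun a b => c b a) a b • x a := funext fun b => (hc b).symm
  rw [hyc]
  refine frameDeg_smul_sum hH hF hx _ fun h0 => ?_
  obtain ⟨σ⟩ : Nonempty (K →+* ℂ) := inferInstance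
  have h2 := gramDet_pos (hH σ) σ hy
  have h3 := gramDet_smul_sum (H σ) σ x
    ((Matrix.of fun a b => c b a).map (algebraMap (𝓞 K) K))
  rw [← RingHom.mapMatrix_apply, ← RingHom.map_det, h0, map_zero, map_zero, map_zero,
    zero_mul] at h3
  rw [hyc] at h2
  exact h2.ne' h3

theorem frameDeg_eq_frameDeg (hH : ∀ σ, (H σ).PosDef) (hF : F.FG) {x : α → ι → K} {y : β → ι → K}
    (hx : IsFrame F x) (hy : IsFrame F y) : frameDeg H F y = frameDeg H F x := by
  have e : α ≃ β := Fintype.equivOfCardEq (by rw [← hx.hRank_eq, hy.hRank_eq])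
  rw [← frameDeg_comp_equiv H F y e]
  replace hy := hy.comp_equiv e
  generalize y ∘ e = z at hy
  clear e
  choose n hn hz using fun a => hx.exists_int_smul_mem_span (hy.mem a)
  have hN : ∏ a, n a ≠ 0 := Finset.prod_ne_zero_iff.mpr fun a _ => hn a
  have hli : LinearIndependent K fun a => (∏ a, n a) • z a := by
    have := hy.linearIndependent.units_smul (fun _ => Units.mk0 ((∏ a, n a : ℤ) : K)
      (by exact_mod_cast hN))
    convert this using 2 with a
    ext i
    simp [Units.smul_def]
  rw [← frameDeg_eq_of_mem_span hH hF hx hli, ← frameDeg_eq_of_mem_span hH hF hy hli]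
  · exact fun a => zsmul_mem (Submodule.subset_span (Set.mem_range_self a)) _
  · intro a
    obtain ⟨k, hk⟩ := Finset.dvd_prod_of_mem n (Finset.mem_univ a)
    rw [hk, mul_comm, mul_smul]
    exact zsmul_mem (hz a) _

theorem hDeg_eq_frameDeg (hH : ∀ σ, (H σ).PosDef) (hF : F.FG) {x : α → ι → K}
    (hx : IsFrame F x) : hDeg K H F = frameDeg H F x := by
  unfold hDeg
  split_ifs with h
  · obtain ⟨-, h1, h2, h3⟩ := h.choose_spec
    generalize h.choose = p at h1 h2 h3
    rw [finsum_eq_sum_of_fintype, ← frameDeg_eq_frameDeg hH hF hx ⟨h1, h2, h3⟩, frameDeg]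
    congr! 5
    unfold gramDet
    congr!
  · obtain ⟨y, hy⟩ := exists_isFrame F
    have h0 : hRank K F = 0 := by
      by_contra h0
      exact h ⟨⟨_, y⟩, Nat.pos_of_ne_zero h0, hy.mem, hy.linearIndependent, hy.mem_span⟩
    rw [hx.hRank_eq, Fintype.card_eq_zero_iff] at h0
    have hb : F = ⊥ := by
      rw [eq_bot_iff]
      intro v hv
      simpa [Set.range_eq_empty] using hx.mem_span v hv
    simp [frameDeg, gramDet, hb]

end Degree

section Submodularity

variable {K ι : Type} [Field K]

theorem span_coe_sup (F G : Submodule (𝓞 K) (ι → K)) :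
    Submodule.span K ((F ⊔ G : Submodule (𝓞 K) (ι → K)) : Set (ι → K)) =
      Submodule.span K (F : Set (ι → K)) ⊔ Submodule.span K (G : Set (ι → K)) := by
  refine le_antisymm (Submodule.span_le.mpr fun v hv => ?_)
    (sup_le (Submodule.span_mono (le_sup_left : F ≤ F ⊔ G))
      (Submodule.span_mono (le_sup_right : G ≤ F ⊔ G)))
  obtain ⟨a, ha, b, hb, rfl⟩ := Submodule.mem_sup.mp hv
  exact Submodule.add_mem_sup (Submodule.subset_span ha) (Submodule.subset_span hb)

variable [NumberField K]

theorem span_coe_inf (F G : Submodule (𝓞 K) (ι → K)) :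
    Submodule.span K ((F ⊓ G : Submodule (𝓞 K) (ι → K)) : Set (ι → K)) =
      Submodule.span K (F : Set (ι → K)) ⊓ Submodule.span K (G : Set (ι → K)) := by
  refine le_antisymm (le_inf (Submodule.span_mono (inf_le_left : F ⊓ G ≤ F))
      (Submodule.span_mono (inf_le_right : F ⊓ G ≤ G))) ?_
  rintro v ⟨hF, hG⟩
  obtain ⟨m, hm, hF⟩ := NumberField.exists_int_smul_mem_of_mem_span hF
  obtain ⟨n, hn, hG⟩ := NumberField.exists_int_smul_mem_of_mem_span hG
  have hmem : (n * m) • v ∈ F ⊓ G :=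
    ⟨by rw [mul_smul]; exact zsmul_mem hF n, by rw [mul_comm, mul_smul]; exact zsmul_mem hG m⟩
  have hnm : ((n * m : ℤ) : K) ≠ 0 := by exact_mod_cast mul_ne_zero hn hm
  have := Submodule.smul_mem _ ((n * m : ℤ) : K)⁻¹ (Submodule.subset_span (R := K) hmem)
  rwa [← Int.cast_smul_eq_zsmul K, inv_smul_smul₀ hnm] at this

theorem IsFrame.sup {α β γ : Type} {F G : Submodule (𝓞 K) (ι → K)} {z : α → ι → K}
    {x : β → ι → K} {y : γ → ι → K} (hz : IsFrame (F ⊓ G) z) (hx : IsFrame F (Sum.elim z x))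
    (hy : IsFrame G (Sum.elim z y)) : IsFrame (F ⊔ G) (Sum.elim z (Sum.elim x y)) := by
  refine .of_span_eq ?_ ?_ ?_
  · rintro (a | a | a)
    · exact Submodule.mem_sup_left (hz.mem a).1
    · exact Submodule.mem_sup_left (hx.mem (Sum.inr a))
    · exact Submodule.mem_sup_right (hy.mem (Sum.inr a))
  · have : LinearIndependent K (Sum.elim (Sum.elim z x) y) := by
      have hy2 := linearIndependent_sum.mp hy.linearIndependent
      refine hx.linearIndependent.sum_type hy2.2.1 ?_
      rw [Submodule.disjoint_def]
      intro v hv hv2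
      refine (Submodule.disjoint_def.mp hy2.2.2) v ?_ hv2
      have h1 : v ∈ Submodule.span K ((F ⊓ G : Submodule (𝓞 K) (ι → K)) : Set (ι → K)) := by
        rw [span_coe_inf, hx.span_eq, hy.span_eq]
        exact ⟨hv, Submodule.span_mono (by
          rw [Set.Sum.elim_range]; exact Set.subset_union_right) hv2⟩
      rwa [hz.span_eq] at h1
    convert this.comp _ (Equiv.sumAssoc α β γ).symm.injective using 1
    ext (a | a | a) <;> rfl
  · rw [span_coe_sup, hx.span_eq, hy.span_eq]
    simp only [Set.Sum.elim_range, Submodule.span_union]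
    rw [← sup_sup_distrib_left]

variable [Fintype ι]

theorem hRank_sup_add_hRank_inf (F G : Submodule (𝓞 K) (ι → K)) :
    hRank K (F ⊔ G) + hRank K (F ⊓ G) = hRank K F + hRank K G := by
  simp only [hRank]
  rw [span_coe_sup, span_coe_inf, Submodule.finrank_sup_add_finrank_inf_eq]

theorem hRank_mono {F G : Submodule (𝓞 K) (ι → K)} (h : F ≤ G) : hRank K F ≤ hRank K G :=
  Submodule.finrank_mono (Submodule.span_mono h)

theorem hRank_bot : hRank K (⊥ : Submodule (𝓞 K) (ι → K)) = 0 := by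
  simp [hRank]

theorem hRank_pos {F : Submodule (𝓞 K) (ι → K)} (h : F ≠ ⊥) : 0 < hRank K F := by
  obtain ⟨v, hv, hv0⟩ := Submodule.exists_mem_ne_zero_of_ne_bot h
  rw [hRank, Module.finrank_pos_iff_exists_ne_zero]
  exact ⟨⟨v, Submodule.subset_span hv⟩, fun h0 => hv0 (congrArg Subtype.val h0)⟩

variable {H : (K →+* ℂ) → Matrix ι ι ℂ}

theorem hDeg_bot (hH : ∀ σ, (H σ).PosDef) : hDeg K H ⊥ = 0 := by
  have hx : IsFrame (⊥ : Submodule (𝓞 K) (ι → K)) (Fin.elim0 : Fin 0 → ι → K) :=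
    ⟨fun a => a.elim0, linearIndependent_empty_type, by simp⟩
  rw [hDeg_eq_frameDeg hH Submodule.fg_bot hx]
  simp [frameDeg, gramDet]

theorem hDeg_le_hDeg_of_span_eq (hH : ∀ σ, (H σ).PosDef) {F G : Submodule (𝓞 K) (ι → K)}
    (hG : G.FG) (h : F ≤ G)
    (hs : Submodule.span K (F : Set (ι → K)) = Submodule.span K (G : Set (ι → K))) :
    hDeg K H F ≤ hDeg K H G := by
  obtain ⟨x, hx⟩ := exists_isFrame F
  have hF := Submodule.FG.of_le hG h
  have hxG : IsFrame G x := .of_span_eq (fun a => h (hx.mem a)) hx.linearIndependent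
    (hs ▸ hx.span_eq)
  rw [hDeg_eq_frameDeg hH hF hx, hDeg_eq_frameDeg hH hG hxG, frameDeg, frameDeg]
  have h0 := hx.relIndex_ne_zero hF
  gcongr
  exact AddSubgroup.relIndex_le_of_le_right (Submodule.toAddSubgroup_mono h)
    (hxG.relIndex_ne_zero hG)

theorem IsFrame.exists_extend {α : Type} {P F : Submodule (𝓞 K) (ι → K)} (h : P ≤ F)
    {z : α → ι → K} (hz : IsFrame P z) :
    ∃ (β : Type) (_ : Fintype β) (x : β → ι → K), IsFrame F (Sum.elim z x) := by
  obtain ⟨b, hbF, hzb, hFb, hb⟩ := exists_linearIndepOn_id_extension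
    hz.linearIndependent.linearIndepOn_id
    (Set.range_subset_iff.mpr fun a => h (hz.mem a) : Set.range z ⊆ F)
  have : Finite b := hb.linearIndependent.finite
  refine ⟨↥(b \ Set.range z), @Fintype.ofFinite _ (Finite.Set.subset b Set.sdiff_subset),
    (↑), ?_, ?_, ?_⟩
  · rintro (a | a)
    · exact h (hz.mem a)
    · exact hbF a.2.1
  · have := hb.linearIndependent.comp
      (Sum.elim (fun a => ⟨z a, hzb ⟨a, rfl⟩⟩) fun a => ⟨a, a.2.1⟩ : α ⊕ ↥(b \ Set.range z) → b) ?_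
    · have e : Sum.elim z ((↑) : ↥(b \ Set.range z) → ι → K) = (fun v : b => id (v : ι → K)) ∘
          (Sum.elim (fun a => ⟨z a, hzb ⟨a, rfl⟩⟩) fun a => ⟨a, a.2.1⟩ :
            α ⊕ ↥(b \ Set.range z) → b) := by
        ext (a | a) <;> rfl
      rw [e]
      exact this
    · refine Function.Injective.sumElim ?_ ?_ ?_
      · intro a a' haa
        exact hz.linearIndependent.injective (congrArg Subtype.val haa)
      · intro a a' haa
        exact Subtype.ext (Subtype.mk.inj haa)
      · intro a a' haa
        exact a'.2.2 ⟨a, congrArg Subtype.val haa⟩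
  · intro y hy
    rw [Set.Sum.elim_range, Subtype.range_coe, Set.union_sdiff_cancel hzb]
    exact hFb hy

theorem hDeg_add_hDeg_le (hH : ∀ σ, (H σ).PosDef) {F G : Submodule (𝓞 K) (ι → K)}
    (hF : F.FG) (hG : G.FG) :
    hDeg K H F + hDeg K H G ≤ hDeg K H (F ⊔ G) + hDeg K H (F ⊓ G) := by
  obtain ⟨z, hz⟩ := exists_isFrame (F ⊓ G)
  obtain ⟨β, _, x, hx⟩ := hz.exists_extend (inf_le_left : F ⊓ G ≤ F)
  obtain ⟨γ, _, y, hy⟩ := hz.exists_extend (inf_le_right : F ⊓ G ≤ G)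
  have hw := hz.sup hx hy
  have hFG := hF.sup hG
  have hFiG : (F ⊓ G).FG := Submodule.FG.of_le hF inf_le_left
  rw [hDeg_eq_frameDeg hH hF hx, hDeg_eq_frameDeg hH hG hy, hDeg_eq_frameDeg hH hFG hw,
    hDeg_eq_frameDeg hH hFiG hz]
  simp only [frameDeg]
  have h1 := AddSubgroup.relIndex_mul_relIndex_of_le (Submodule.toAddSubgroup_mono hx.span_le)
    (Submodule.toAddSubgroup_mono hy.span_le)
  rw [← Submodule.sup_toAddSubgroup, ← Submodule.sup_toAddSubgroup, ← Submodule.span_union] at h1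
  have e : F.toAddSubgroup ⊓ G.toAddSubgroup = (F ⊓ G).toAddSubgroup := by ext; rfl
  rw [e] at h1
  have h2 : Set.range (Sum.elim z x) ∪ Set.range (Sum.elim z y) =
      Set.range (Sum.elim z (Sum.elim x y)) := by
    simp only [Set.Sum.elim_range]
    rw [← Set.union_union_distrib_left]
  rw [h2] at h1
  have h3 : ((Submodule.span (𝓞 K) (Set.range (Sum.elim z x))).toAddSubgroup ⊓
      (Submodule.span (𝓞 K) (Set.range (Sum.elim z y))).toAddSubgroup).relIndex
        (F ⊓ G).toAddSubgroup ≤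
      (Submodule.span (𝓞 K) (Set.range z)).toAddSubgroup.relIndex (F ⊓ G).toAddSubgroup := by
    refine AddSubgroup.relIndex_le_of_le_left ?_ (hz.relIndex_ne_zero hFiG)
    refine le_inf (Submodule.toAddSubgroup_mono ?_) (Submodule.toAddSubgroup_mono ?_) <;>
    · refine Submodule.span_mono ?_
      rw [Set.Sum.elim_range]
      exact Set.subset_union_left
  have h4 : Real.log ((Submodule.span (𝓞 K) (Set.range (Sum.elim z x))).toAddSubgroup.relIndex
        F.toAddSubgroup) +
      Real.log ((Submodule.span (𝓞 K) (Set.range (Sum.elim z y))).toAddSubgroup.relIndex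
        G.toAddSubgroup) ≤
      Real.log ((Submodule.span (𝓞 K)
        (Set.range (Sum.elim z (Sum.elim x y)))).toAddSubgroup.relIndex (F ⊔ G).toAddSubgroup) +
      Real.log ((Submodule.span (𝓞 K) (Set.range z)).toAddSubgroup.relIndex
        (F ⊓ G).toAddSubgroup) := by
    have hx0 := hx.relIndex_ne_zero hF
    have hy0 := hy.relIndex_ne_zero hG
    have hw0 := hw.relIndex_ne_zero hFG
    have hz0 := hz.relIndex_ne_zero hFiG
    rw [← Real.log_mul (by exact_mod_cast hx0) (by exact_mod_cast hy0),
      ← Real.log_mul (by exact_mod_cast hw0) (by exact_mod_cast hz0)]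
    refine Real.log_le_log ?_ ?_
    · exact_mod_cast Nat.pos_of_ne_zero (mul_ne_zero hx0 hy0)
    · exact_mod_cast h1.trans_le (Nat.mul_le_mul_left _ h3)
  have h5 : ∑ σ : K →+* ℂ, Real.log (Real.sqrt (gramDet (H σ) σ (Sum.elim z (Sum.elim x y)))) +
      ∑ σ : K →+* ℂ, Real.log (Real.sqrt (gramDet (H σ) σ z)) ≤
      ∑ σ : K →+* ℂ, Real.log (Real.sqrt (gramDet (H σ) σ (Sum.elim z x))) +
      ∑ σ : K →+* ℂ, Real.log (Real.sqrt (gramDet (H σ) σ (Sum.elim z y))) := by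
    rw [← Finset.sum_add_distrib, ← Finset.sum_add_distrib]
    refine Finset.sum_le_sum fun σ _ => ?_
    have hwp := gramDet_pos (hH σ) σ hw.linearIndependent
    have hzp := gramDet_pos (hH σ) σ hz.linearIndependent
    have hxp := gramDet_pos (hH σ) σ hx.linearIndependent
    have hyp := gramDet_pos (hH σ) σ hy.linearIndependent
    rw [← Real.log_mul (Real.sqrt_pos.mpr hwp).ne' (Real.sqrt_pos.mpr hzp).ne',
      ← Real.log_mul (Real.sqrt_pos.mpr hxp).ne' (Real.sqrt_pos.mpr hyp).ne',
      ← Real.sqrt_mul hwp.le, ← Real.sqrt_mul hxp.le]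
    refine Real.log_le_log (Real.sqrt_pos.mpr (mul_pos hwp hzp)) (Real.sqrt_le_sqrt ?_)
    have := gramDet_mul_le (hH σ) σ _ hw.linearIndependent
    simpa only [Sum.elim_comp_inl, Sum.elim_comp_map, Function.comp_id,
      Sum.elim_comp_inr] using this
  linarith

end Submodularity

section IndexBaseChange

theorem Submodule.relIndex_sup_span_singleton {R M : Type*} [CommRing R] [AddCommGroup M]
    [Module R M] (A : Submodule R M) (b : M) :
    A.toAddSubgroup.relIndex (A ⊔ Submodule.span R {b}).toAddSubgroup =
      (A.comap (LinearMap.toSpanSingleton R M b)).toAddSubgroup.index := by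
  rw [Submodule.sup_toAddSubgroup, AddSubgroup.relIndex_sup_left,
    ← LinearMap.range_toSpanSingleton, ← Submodule.map_top, ← AddSubgroup.relIndex_top_right]
  exact (AddSubgroup.relIndex_comap A.toAddSubgroup
    (LinearMap.toSpanSingleton R M b).toAddMonoidHom ⊤).symm

theorem relIndex_map_nsmul_span {K ι α : Type} [Field K] [NumberField K]
    [Fintype α] {x : α → ι → K} (hx : LinearIndependent K x) {n : ℕ}
    (hn : n ≠ 0) :
    ((Submodule.span (𝓞 K) (Set.range x)).map (n • LinearMap.id)).toAddSubgroup.relIndex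
      (Submodule.span (𝓞 K) (Set.range x)).toAddSubgroup =
        n ^ (Module.finrank ℚ K * Fintype.card α) := by
  have h := relIndex_span_smul_sum hx (n • (1 : Matrix α α (𝓞 K))) (by
    simp [← Nat.cast_smul_eq_nsmul (𝓞 K), hn])
  have h1 : (fun b => ∑ a, (n • (1 : Matrix α α (𝓞 K))) a b • x a) = fun b => n • x b := by
    funext b
    rw [Finset.sum_eq_single b]
    · simp [← Nat.cast_smul_eq_nsmul (𝓞 K), Matrix.smul_apply]
    · intro a _ hab
      simp [Matrix.one_apply_ne hab]
    · simp
  rw [h1, ← Nat.cast_smul_eq_nsmul (𝓞 K), Matrix.det_smul, Matrix.det_one, mul_one, map_pow] at h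
  have h2 : Algebra.norm ℤ (n : 𝓞 K) = (n : ℤ) ^ Module.finrank ℚ K := by
    rw [← NumberField.RingOfIntegers.rank, ← Algebra.norm_algebraMap]
    simp
  rw [h2, ← pow_mul] at h
  rw [Submodule.map_span, ← Set.range_comp]
  rw [Int.natAbs_pow, Int.natAbs_natCast] at h
  exact h

variable (K K' : Type) [Field K] [Field K'] [Algebra K K'] {ι α : Type}

/-- Coordinatewise extension of scalars `K^ι → K'^ι`. -/
def coordMap : (ι → K) →ₗ[K] (ι → K') :=
  (Algebra.linearMap K K').compLeft ι

@[simp] theorem coordMap_apply (v : ι → K) (i : ι) : coordMap K K' v i = algebraMap K K' (v i) :=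
  rfl

theorem coordMap_smul (c : 𝓞 K) (v : ι → K) :
    coordMap K K' (c • v) = algebraMap (𝓞 K) (𝓞 K') c • coordMap K K' v := by
  ext i
  simp only [coordMap_apply, Pi.smul_apply, Algebra.smul_def, map_mul]
  rfl

variable {K} in
theorem LinearIndependent.coordMap [Fintype ι] [Fintype α] {x : α → ι → K}
    (hx : LinearIndependent K x) : LinearIndependent K' fun a => coordMap K K' (x a) := by
  obtain ⟨B, hB⟩ := hx.exists_mul_eq_one
  have h := congrArg (fun X : Matrix α α K => X.map (algebraMap K K')) hB
  simp only [Matrix.map_mul] at h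
  rw [Matrix.map_one _ (map_zero _) (map_one _)] at h
  have hinj : Function.Injective
      (Matrix.of fun i a => _root_.coordMap K K' (x a) i : Matrix ι α K').mulVec := by
    intro u v huv
    have := congrArg (B.map (algebraMap K K')).mulVec huv
    rw [Matrix.mulVec_mulVec, Matrix.mulVec_mulVec] at this
    change (B.map (algebraMap K K') * (Matrix.of fun i a => x a i).map (algebraMap K K')) *ᵥ u =
      (B.map (algebraMap K K') * (Matrix.of fun i a => x a i).map (algebraMap K K')) *ᵥ v at this
    rwa [h, Matrix.one_mulVec, Matrix.one_mulVec] at this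
  exact Matrix.mulVec_injective_iff.mp hinj

variable [NumberField K] [NumberField K'] [Fintype ι]

theorem baseChange_eq_span (F : Submodule (𝓞 K) (ι → K)) :
    baseChange K K' F = Submodule.span (𝓞 K') (coordMap K K' '' F) := rfl

variable {K}

theorem coordMap_mem_baseChange {F : Submodule (𝓞 K) (ι → K)} {v : ι → K} (hv : v ∈ F) :
    coordMap K K' v ∈ baseChange K K' F :=
  Submodule.subset_span ⟨v, hv, rfl⟩

theorem baseChange_mono {F G : Submodule (𝓞 K) (ι → K)} (h : F ≤ G) :
    baseChange K K' F ≤ baseChange K K' G :=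
  Submodule.span_mono (Set.image_mono h)

theorem baseChange_span (S : Set (ι → K)) :
    baseChange K K' (Submodule.span (𝓞 K) S) = Submodule.span (𝓞 K') (coordMap K K' '' S) := by
  refine le_antisymm (Submodule.span_le.mpr ?_)
    (Submodule.span_mono (Set.image_mono Submodule.subset_span))
  rintro _ ⟨v, hv, rfl⟩
  change coordMap K K' v ∈ Submodule.span (𝓞 K') (coordMap K K' '' S)
  induction hv using Submodule.span_induction with
  | mem v hv => exact Submodule.subset_span ⟨v, hv, rfl⟩
  | zero => rw [map_zero]; exact zero_mem _
  | add v w _ _ hv hw => rw [map_add]; exact add_mem hv hw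
  | smul c v _ hv => rw [coordMap_smul]; exact Submodule.smul_mem _ _ hv

theorem baseChange_sup (F G : Submodule (𝓞 K) (ι → K)) :
    baseChange K K' (F ⊔ G) = baseChange K K' F ⊔ baseChange K K' G := by
  have h : F ⊔ G = Submodule.span (𝓞 K) ((F : Set (ι → K)) ∪ G) := by
    rw [Submodule.span_union, Submodule.span_eq, Submodule.span_eq]
  rw [h, baseChange_span, Set.image_union, Submodule.span_union]
  rfl

theorem baseChange_fg {F : Submodule (𝓞 K) (ι → K)} (hF : F.FG) : (baseChange K K' F).FG := by
  obtain ⟨S, rfl⟩ := hF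
  rw [baseChange_span]
  exact Submodule.fg_span (S.finite_toSet.image _)

theorem baseChange_map_nsmul (F : Submodule (𝓞 K) (ι → K)) (n : ℕ) :
    baseChange K K' (F.map (n • LinearMap.id)) =
      (baseChange K K' F).map (n • LinearMap.id) := by
  rw [baseChange_eq_span, baseChange_eq_span, Submodule.map_span]
  congr 1
  simp only [Submodule.map_coe, Set.image_image, LinearMap.smul_apply, LinearMap.id_apply,
    map_nsmul]

theorem span_baseChange (F : Submodule (𝓞 K) (ι → K)) :
    Submodule.span K' (baseChange K K' F : Set (ι → K')) =
      Submodule.span K' (coordMap K K' '' Submodule.span K (F : Set (ι → K))) := by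
  rw [baseChange_eq_span]
  refine le_antisymm (Submodule.span_le.mpr ?_) (Submodule.span_le.mpr ?_)
  · refine fun v hv => Submodule.span_mono (Set.image_mono Submodule.subset_span)
      (Submodule.span_le_restrictScalars (𝓞 K') K' _ hv)
  · rintro _ ⟨v, hv, rfl⟩
    rw [SetLike.mem_coe] at hv ⊢
    induction hv using Submodule.span_induction with
    | mem v hv => exact Submodule.subset_span (coordMap_mem_baseChange K' hv)
    | zero => rw [map_zero]; exact zero_mem _
    | add v w _ _ hv hw => rw [map_add]; exact add_mem hv hw
    | smul c v _ hv =>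
      rw [map_smul, ← algebraMap_smul K' c]
      exact Submodule.smul_mem _ _ hv

theorem IsFrame.baseChange [Fintype α] {F : Submodule (𝓞 K) (ι → K)} {x : α → ι → K}
    (hx : IsFrame F x) :
    IsFrame (baseChange K K' F) fun a => _root_.coordMap K K' (x a) := by
  refine .of_span_eq (fun a => coordMap_mem_baseChange K' (hx.mem a))
    (hx.linearIndependent.coordMap K') ?_
  have h := span_baseChange K' (Submodule.span (𝓞 K) (Set.range x))
  rw [Submodule.span_span_of_tower, ← hx.span_eq, ← span_baseChange, baseChange_span,
    ← Set.range_comp, Submodule.span_span_of_tower] at h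
  exact h.symm

theorem hRank_baseChange (F : Submodule (𝓞 K) (ι → K)) :
    hRank K' (baseChange K K' F) = hRank K F := by
  obtain ⟨x, hx⟩ := exists_isFrame F
  rw [hx.hRank_eq, (hx.baseChange K').hRank_eq]

theorem finrank_ringOfIntegers_eq : Module.finrank (𝓞 K) (𝓞 K') = Module.finrank K K' :=
  (IsFractionRing.finrank_eq (𝓞 K) K (𝓞 K') K').symm

theorem relIndex_baseChange_le (A B : Submodule (𝓞 K) (ι → K)) (hAB : A ≤ B)
    (h0 : A.toAddSubgroup.relIndex B.toAddSubgroup ≠ 0) :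
    (baseChange K K' A).toAddSubgroup.relIndex (baseChange K K' B).toAddSubgroup ≠ 0 ∧
      (baseChange K K' A).toAddSubgroup.relIndex (baseChange K K' B).toAddSubgroup ≤
        A.toAddSubgroup.relIndex B.toAddSubgroup ^ Module.finrank K K' := by
  induction hn : A.toAddSubgroup.relIndex B.toAddSubgroup using Nat.strong_induction_on
    generalizing A with
  | _ n ih =>
  by_cases hBA : B ≤ A
  · have h1 : A = B := le_antisymm hAB hBA
    subst h1
    rw [AddSubgroup.relIndex_self] at hn
    simp [← hn]
  obtain ⟨b, hbB, hbA⟩ := Set.not_subset.mp hBA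
  set C := A ⊔ Submodule.span (𝓞 K) {b} with hC
  have hAC : A ≤ C := le_sup_left
  have hCB : C ≤ B := sup_le hAB (by simpa using hbB)
  have hmul := AddSubgroup.relIndex_mul_relIndex _ _ _
    (Submodule.toAddSubgroup_mono hAC) (Submodule.toAddSubgroup_mono hCB)
  have hmul' := AddSubgroup.relIndex_mul_relIndex _ _ _
    (Submodule.toAddSubgroup_mono (baseChange_mono K' hAC))
    (Submodule.toAddSubgroup_mono (baseChange_mono K' hCB))
  have hAC0 : A.toAddSubgroup.relIndex C.toAddSubgroup ≠ 0 := fun h => h0 (by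
    rw [← hmul, h, zero_mul])
  have hCB0 : C.toAddSubgroup.relIndex B.toAddSubgroup ≠ 0 := fun h => h0 (by
    rw [← hmul, h, mul_zero])
  have hAC1 : A.toAddSubgroup.relIndex C.toAddSubgroup ≠ 1 := fun h =>
    hbA ((AddSubgroup.relIndex_eq_one.mp h)
      (Submodule.mem_sup_right (Submodule.mem_span_singleton_self b) : b ∈ C))
  obtain ⟨ih0, ih⟩ := ih _ (by
    rw [← hn, ← hmul]
    exact (lt_mul_iff_one_lt_left (Nat.pos_of_ne_zero hCB0)).mpr (by omega)) C hCB hCB0 rfl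
  have hC' : baseChange K K' C =
      baseChange K K' A ⊔ Submodule.span (𝓞 K') {coordMap K K' b} := by
    rw [hC, baseChange_sup, baseChange_span, Set.image_singleton]
  set I : Ideal (𝓞 K) := A.comap (LinearMap.toSpanSingleton (𝓞 K) (ι → K) b) with hI
  set I' : Ideal (𝓞 K') := (baseChange K K' A).comap
    (LinearMap.toSpanSingleton (𝓞 K') (ι → K') (coordMap K K' b)) with hI'
  have h1 : A.toAddSubgroup.relIndex C.toAddSubgroup = Ideal.absNorm I :=
    A.relIndex_sup_span_singleton b
  have h2 : (baseChange K K' A).toAddSubgroup.relIndex (baseChange K K' C).toAddSubgroup =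
      Ideal.absNorm I' := by
    rw [hC']
    exact (baseChange K K' A).relIndex_sup_span_singleton _
  have h3 : I.map (algebraMap (𝓞 K) (𝓞 K')) ≤ I' := by
    refine Ideal.map_le_iff_le_comap.mpr fun c hc => ?_
    have := coordMap_mem_baseChange K' hc
    rw [LinearMap.toSpanSingleton_apply, coordMap_smul] at this
    exact this
  have h4 : Ideal.absNorm (I.map (algebraMap (𝓞 K) (𝓞 K'))) =
      Ideal.absNorm I ^ Module.finrank K K' := by
    rw [Ideal.absNorm_algebraMap, finrank_ringOfIntegers_eq]
  have h5 := Ideal.absNorm_dvd_absNorm_of_le h3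
  rw [h4, ← h1, ← h2] at h5
  have h6 : A.toAddSubgroup.relIndex C.toAddSubgroup ^ Module.finrank K K' ≠ 0 :=
    pow_ne_zero _ hAC0
  refine ⟨?_, ?_⟩
  · rw [← hmul']
    exact mul_ne_zero (ne_zero_of_dvd_ne_zero h6 h5) ih0
  · rw [← hmul', ← hn, ← hmul, mul_pow]
    exact Nat.mul_le_mul (Nat.le_of_dvd (Nat.pos_of_ne_zero h6) h5) ih

theorem relIndex_span_baseChange [Fintype α] {F : Submodule (𝓞 K) (ι → K)} (hF : F.FG)
    {x : α → ι → K} (hx : IsFrame F x) :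
    (Submodule.span (𝓞 K') (Set.range fun a => coordMap K K' (x a))).toAddSubgroup.relIndex
      (baseChange K K' F).toAddSubgroup =
    (Submodule.span (𝓞 K) (Set.range x)).toAddSubgroup.relIndex F.toAddSubgroup ^
      Module.finrank K K' := by
  set A := Submodule.span (𝓞 K) (Set.range x) with hA
  set d := Module.finrank K K'
  have hA' : Submodule.span (𝓞 K') (Set.range fun a => coordMap K K' (x a)) =
      baseChange K K' A := by
    rw [hA, baseChange_span, ← Set.range_comp]
    rfl
  set n := A.toAddSubgroup.relIndex F.toAddSubgroup with hn
  have hn0 : n ≠ 0 := hx.relIndex_ne_zero hF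
  have hAF : A ≤ F := hx.span_le
  have hNF : F.map (n • LinearMap.id) ≤ A := by
    rintro _ ⟨v, hv, rfl⟩
    exact A.toAddSubgroup.nsmul_relIndex_mem hv
  have hNA : A.map (n • LinearMap.id) ≤ F.map (n • LinearMap.id) := Submodule.map_mono hAF
  have inj : ∀ (L : Type) [Field L] [NumberField L],
      Function.Injective (n • LinearMap.id : (ι → L) →ₗ[𝓞 L] (ι → L)) := fun L _ _ =>
    smul_right_injective (ι → L) hn0
  have e1 := AddSubgroup.relIndex_map_map_of_injective A.toAddSubgroup F.toAddSubgroup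
    (f := (n • LinearMap.id : (ι → K) →ₗ[𝓞 K] (ι → K)).toAddMonoidHom) (inj K)
  have e2 := AddSubgroup.relIndex_map_map_of_injective (baseChange K K' A).toAddSubgroup
    (baseChange K K' F).toAddSubgroup
    (f := (n • LinearMap.id : (ι → K') →ₗ[𝓞 K'] (ι → K')).toAddMonoidHom) (inj K')
  change (A.map (n • LinearMap.id)).toAddSubgroup.relIndex
    (F.map (n • LinearMap.id)).toAddSubgroup = _ at e1
  change ((baseChange K K' A).map (n • LinearMap.id)).toAddSubgroup.relIndex
    ((baseChange K K' F).map (n • LinearMap.id)).toAddSubgroup = _ at e2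
  have m1 := AddSubgroup.relIndex_mul_relIndex _ _ _
    (Submodule.toAddSubgroup_mono hNA) (Submodule.toAddSubgroup_mono hNF)
  have m2 := AddSubgroup.relIndex_mul_relIndex _ _ _
    (Submodule.toAddSubgroup_mono (baseChange_mono K' hNA))
    (Submodule.toAddSubgroup_mono (baseChange_mono K' hNF))
  simp only [baseChange_map_nsmul] at m2
  rw [e1, relIndex_map_nsmul_span hx.linearIndependent hn0] at m1
  rw [e2, ← hA', relIndex_map_nsmul_span (hx.linearIndependent.coordMap K') hn0, hA',
    ← baseChange_map_nsmul, ← Module.finrank_mul_finrank ℚ K K', mul_right_comm, pow_mul, ← m1,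
    mul_pow] at m2
  have hv0 : (F.map (n • LinearMap.id)).toAddSubgroup.relIndex A.toAddSubgroup ≠ 0 := by
    intro h
    rw [h, mul_zero] at m1
    exact pow_ne_zero _ hn0 m1.symm
  obtain ⟨u0, u⟩ := relIndex_baseChange_le K' _ _ hAF hn0
  obtain ⟨v0, v⟩ := relIndex_baseChange_le K' _ _ hNF hv0
  rw [hA']
  refine le_antisymm u (Nat.le_of_mul_le_mul_right ?_ (Nat.pos_of_ne_zero v0))
  rw [m2]
  exact Nat.mul_le_mul_left _ v

end IndexBaseChange

section DegreeBaseChange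

variable {K : Type} (K' : Type) [Field K] [Field K'] [Algebra K K'] {ι : Type}

theorem posDef_baseChangeMetric {H : (K →+* ℂ) → Matrix ι ι ℂ} (hH : ∀ σ, (H σ).PosDef) :
    ∀ σ, (baseChangeMetric K K' H σ).PosDef :=
  fun _ => hH _

theorem baseChangeMetric_baseChangeMetric (K'' : Type) [Field K''] [Algebra K' K'']
    [Algebra K K''] [IsScalarTower K K' K''] (H : (K →+* ℂ) → Matrix ι ι ℂ) :
    baseChangeMetric K' K'' (baseChangeMetric K K' H) = baseChangeMetric K K'' H := by
  ext σ : 1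
  simp only [baseChangeMetric, RingHom.comp_assoc, ← IsScalarTower.algebraMap_eq]

variable [NumberField K] [NumberField K'] [Fintype ι]

theorem card_embeddings_extending (σ : K →+* ℂ) :
    Fintype.card {σ' : K' →+* ℂ // σ'.comp (algebraMap K K') = σ} = Module.finrank K K' := by
  let _ : Algebra K ℂ := σ.toAlgebra
  rw [← AlgHom.card K K' ℂ]
  refine Fintype.card_congr
    { toFun := fun σ' => { σ'.1 with commutes' := fun c => congrArg (· c) σ'.2 }
      invFun := fun φ => ⟨φ.toRingHom, φ.comp_algebraMap⟩
      left_inv := fun _ => rfl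
      right_inv := fun _ => rfl }

theorem sum_comp_algebraMap (f : (K →+* ℂ) → ℝ) :
    ∑ σ' : K' →+* ℂ, f (σ'.comp (algebraMap K K')) =
      Module.finrank K K' * ∑ σ : K →+* ℂ, f σ := by
  rw [← Fintype.sum_fiberwise (fun σ' : K' →+* ℂ => σ'.comp (algebraMap K K')), Finset.mul_sum]
  refine Finset.sum_congr rfl fun σ _ => ?_
  rw [Finset.sum_congr rfl fun (σ' : {σ' : K' →+* ℂ // σ'.comp (algebraMap K K') = σ}) _ =>
    congrArg f σ'.2]
  simp [← card_embeddings_extending K' σ]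

theorem hDeg_baseChange {H : (K →+* ℂ) → Matrix ι ι ℂ} (hH : ∀ σ, (H σ).PosDef)
    {F : Submodule (𝓞 K) (ι → K)} (hF : F.FG) :
    hDeg K' (baseChangeMetric K K' H) (baseChange K K' F) =
      Module.finrank K K' * hDeg K H F := by
  obtain ⟨x, hx⟩ := exists_isFrame F
  rw [hDeg_eq_frameDeg hH hF hx, hDeg_eq_frameDeg (posDef_baseChangeMetric K' hH)
    (baseChange_fg K' hF) (hx.baseChange K'), frameDeg, frameDeg, relIndex_span_baseChange K' hF hx,
    mul_sub, ← sum_comp_algebraMap K' fun σ => Real.log (Real.sqrt (gramDet (H σ) σ x))]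
  rw [Nat.cast_pow, Real.log_pow]
  rfl

theorem hMu_baseChange {H : (K →+* ℂ) → Matrix ι ι ℂ} (hH : ∀ σ, (H σ).PosDef)
    {F : Submodule (𝓞 K) (ι → K)} (hF : F.FG) :
    hMu K' (baseChangeMetric K K' H) (baseChange K K' F) = Module.finrank K K' * hMu K H F := by
  rw [hMu, hMu, hDeg_baseChange K' hH hF, hRank_baseChange, mul_div_assoc]

theorem baseChange_ne_bot {F : Submodule (𝓞 K) (ι → K)} (hF : F ≠ ⊥) :
    baseChange K K' F ≠ ⊥ := by
  intro h
  have h1 := hRank_pos hF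
  rw [← hRank_baseChange K' F, h, hRank_bot] at h1
  exact h1.false

theorem baseChange_baseChange (K'' : Type) [Field K''] [NumberField K''] [Algebra K' K'']
    [Algebra K K''] [IsScalarTower K K' K''] (F : Submodule (𝓞 K) (ι → K)) :
    baseChange K' K'' (baseChange K K' F) = baseChange K K'' F := by
  rw [baseChange_eq_span K K', baseChange_span, baseChange_eq_span, ← Set.image_comp]
  congr 2
  ext v i
  exact (IsScalarTower.algebraMap_apply K K' K'' (v i)).symm

end DegreeBaseChange

section Conjugate

variable {K L : Type} [Field K] [Field L] [NumberField L] [Algebra K L]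
  {ι : Type} [Fintype ι]

/-- The image of an `𝒪_L`-submodule of `L^ι` under an automorphism of `L` acting on coordinates. -/
def conjSubmodule (g : L ≃ₐ[K] L) (F : Submodule (𝓞 L) (ι → L)) : Submodule (𝓞 L) (ι → L) :=
  let _ : Algebra L L := (g : L →+* L).toAlgebra
  baseChange L L F

theorem mem_conjSubmodule (g : L ≃ₐ[K] L) {F : Submodule (𝓞 L) (ι → L)} {v : ι → L} (hv : v ∈ F) :
    (fun i => g (v i)) ∈ conjSubmodule g F :=
  Submodule.subset_span ⟨v, hv, rfl⟩

theorem conjSubmodule_le_iff (g : L ≃ₐ[K] L) {F G : Submodule (𝓞 L) (ι → L)} :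
    conjSubmodule g F ≤ G ↔ ∀ v ∈ F, (fun i => g (v i)) ∈ G :=
  Submodule.span_le.trans Set.forall_mem_image

theorem conjSubmodule_one (F : Submodule (𝓞 L) (ι → L)) :
    conjSubmodule (1 : L ≃ₐ[K] L) F = F :=
  le_antisymm ((conjSubmodule_le_iff _).mpr fun _ hv => hv) fun _ hv => mem_conjSubmodule 1 hv

theorem apply_mem_conjSubmodule_mul (g h : L ≃ₐ[K] L) {F : Submodule (𝓞 L) (ι → L)} {v : ι → L}
    (hv : v ∈ conjSubmodule h F) : (fun i => g (v i)) ∈ conjSubmodule (g * h) F := by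
  replace hv : v ∈ Submodule.span (𝓞 L) ((fun (v : ι → L) i => h (v i)) '' F) := hv
  let _ : Algebra L L := (g : L →+* L).toAlgebra
  change coordMap L L v ∈ _
  induction hv using Submodule.span_induction with
  | mem v hv =>
    obtain ⟨w, hw, rfl⟩ := hv
    exact mem_conjSubmodule (g * h) hw
  | zero => rw [map_zero]; exact zero_mem _
  | add v w _ _ hv hw => rw [map_add]; exact add_mem hv hw
  | smul c v _ hv => rw [coordMap_smul]; exact Submodule.smul_mem _ _ hv

theorem hRank_conjSubmodule (g : L ≃ₐ[K] L) (F : Submodule (𝓞 L) (ι → L)) :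
    hRank L (conjSubmodule g F) = hRank L F :=
  let _ : Algebra L L := (g : L →+* L).toAlgebra
  hRank_baseChange L F

theorem Module.finrank_eq_one_of_surjective_algebraMap {A B : Type*} [Field A] [Field B]
    [Algebra A B] (h : Function.Surjective (algebraMap A B)) : Module.finrank A B = 1 := by
  refine finrank_eq_one 1 one_ne_zero fun w => ?_
  obtain ⟨c, rfl⟩ := h w
  exact ⟨c, by rw [Algebra.smul_def, mul_one]⟩

theorem hDeg_conjSubmodule [NumberField K] {H : (K →+* ℂ) → Matrix ι ι ℂ} (hH : ∀ σ, (H σ).PosDef)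
    (g : L ≃ₐ[K] L) {F : Submodule (𝓞 L) (ι → L)} (hF : F.FG) :
    hDeg L (baseChangeMetric K L H) (conjSubmodule g F) = hDeg L (baseChangeMetric K L H) F := by
  have key := @hDeg_baseChange L L _ _ (g : L →+* L).toAlgebra ι _ _ _ _
    (posDef_baseChangeMetric L hH) F hF
  have h1 : @Module.finrank L L _ _ (g : L →+* L).toAlgebra.toModule = 1 :=
    @Module.finrank_eq_one_of_surjective_algebraMap L L _ _ (g : L →+* L).toAlgebra g.surjective
  have h2 : @baseChangeMetric L L _ _ (g : L →+* L).toAlgebra ι (baseChangeMetric K L H) =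
      baseChangeMetric K L H := by
    ext σ : 1
    unfold baseChangeMetric
    rw [RingHom.comp_assoc]
    exact congrArg (fun τ => H (σ.comp τ)) (RingHom.ext g.commutes)
  rw [h1, h2, Nat.cast_one, one_mul] at key
  exact key

end Conjugate

section Slopes

variable {K ι : Type} [Field K] [NumberField K] [Fintype ι] {H : (K →+* ℂ) → Matrix ι ι ℂ}

theorem exists_hDeg_le (hH : ∀ σ, (H σ).PosDef) {P : Submodule (𝓞 K) (ι → K)} (hP : P.FG) :
    ∃ C, ∀ F ≤ P, hDeg K H F ≤ C := by
  induction hn : hRank K P generalizing P with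
  | zero =>
    have hP0 : P = ⊥ := by_contra fun h => (hRank_pos h).ne' hn
    exact ⟨0, fun F hF => by rw [le_bot_iff.mp (hF.trans hP0.le), hDeg_bot hH]⟩
  | succ m ih =>
    obtain ⟨x, hx⟩ := exists_isFrame P
    replace hx := hx.comp_equiv (finCongr hn.symm)
    set y : Fin m → ι → K := fun a => (x ∘ finCongr hn.symm) a.castSucc
    set P₀ := P ⊓ (Submodule.span K (Set.range y)).restrictScalars (𝓞 K)
    have hy : IsFrame P₀ y :=
      ⟨fun a => ⟨hx.mem _, Submodule.subset_span ⟨a, rfl⟩⟩,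
        hx.linearIndependent.comp _ (Fin.castSucc_injective m), fun v hv => hv.2⟩
    have hr : hRank K P₀ = m := by simpa using hy.hRank_eq
    have hP₀ : P₀ ≤ P := inf_le_left
    have hfg := hP.of_le hP₀
    obtain ⟨C, hC⟩ := ih hfg hr
    refine ⟨max C (hDeg K H P + C - hDeg K H P₀), fun F hF => ?_⟩
    by_cases hFP : F ≤ P₀
    · exact le_max_of_le_left (hC F hFP)
    refine le_max_of_le_right ?_
    have hsup : F ⊔ P₀ ≤ P := sup_le hF hP₀
    have hlt : hRank K P₀ < hRank K (F ⊔ P₀) := by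
      refine Submodule.finrank_lt_finrank_of_lt (lt_of_le_of_ne
        (Submodule.span_mono (le_sup_right : P₀ ≤ F ⊔ P₀)) fun h => hFP fun v hv => ⟨hF hv, ?_⟩)
      change v ∈ Submodule.span K (Set.range y)
      rw [← hy.span_eq, h]
      exact Submodule.subset_span ((le_sup_left : F ≤ F ⊔ P₀) hv)
    have hle := hRank_mono hsup
    have hs := Submodule.eq_of_le_of_finrank_eq (Submodule.span_mono hsup :
      Submodule.span K ((F ⊔ P₀ : Submodule (𝓞 K) (ι → K)) : Set (ι → K)) ≤ _)
      (by change hRank K _ = hRank K _; lia)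
    have h1 := hDeg_le_hDeg_of_span_eq hH hP hsup hs
    have h2 := hDeg_add_hDeg_le hH (hP.of_le hF) hfg
    have h3 := hC (F ⊓ P₀) inf_le_right
    linarith

theorem bddAbove_hMu (hH : ∀ σ, (H σ).PosDef) {E : Submodule (𝓞 K) (ι → K)} (hE : E.FG) :
    BddAbove {m : ℝ | ∃ F : Submodule (𝓞 K) (ι → K), F ≠ ⊥ ∧ F ≤ E ∧ m = hMu K H F} := by
  obtain ⟨C, hC⟩ := exists_hDeg_le hH hE
  refine ⟨max C 0, ?_⟩
  rintro _ ⟨F, hF0, hF, rfl⟩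
  have h1 : (1 : ℝ) ≤ hRank K F := by exact_mod_cast hRank_pos hF0
  rw [hMu, div_le_iff₀ (by linarith)]
  nlinarith [hC F hF, le_max_left C 0, le_max_right C 0]

theorem hMu_le_hMuMax (hH : ∀ σ, (H σ).PosDef) {E F : Submodule (𝓞 K) (ι → K)} (hE : E.FG)
    (hF : F ≠ ⊥) (h : F ≤ E) : hMu K H F ≤ hMuMax K H E :=
  le_csSup (bddAbove_hMu hH hE) ⟨F, hF, h, rfl⟩

theorem hDeg_le_hMuMax_mul (hH : ∀ σ, (H σ).PosDef) {E F : Submodule (𝓞 K) (ι → K)} (hE : E.FG)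
    (h : F ≤ E) : hDeg K H F ≤ hMuMax K H E * hRank K F := by
  rcases eq_or_ne F ⊥ with rfl | hF
  · simp [hDeg_bot hH, hRank_bot]
  · have := hMu_le_hMuMax hH hE hF h
    rwa [hMu, div_le_iff₀ (by exact_mod_cast hRank_pos hF)] at this

theorem hMuMax_le {E : Submodule (𝓞 K) (ι → K)} (hE : E ≠ ⊥) {c : ℝ}
    (h : ∀ F : Submodule (𝓞 K) (ι → K), F ≠ ⊥ → F ≤ E → hMu K H F ≤ c) : hMuMax K H E ≤ c :=
  csSup_le ⟨_, E, hE, le_rfl, rfl⟩ fun _ ⟨F, hF, hFE, hm⟩ => hm ▸ h F hF hFE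

theorem mul_hMuMax_le_hMuMax_baseChange (K' : Type) [Field K'] [NumberField K'] [Algebra K K']
    (hH : ∀ σ, (H σ).PosDef) {E : Submodule (𝓞 K) (ι → K)} (hE : E.FG) (hE0 : E ≠ ⊥) :
    Module.finrank K K' * hMuMax K H E ≤
      hMuMax K' (baseChangeMetric K K' H) (baseChange K K' E) := by
  have hd : (0 : ℝ) < Module.finrank K K' := by exact_mod_cast Module.finrank_pos
  rw [← le_div_iff₀' hd]
  refine hMuMax_le hE0 fun F hF hFE => ?_
  rw [le_div_iff₀' hd, ← hMu_baseChange K' hH (hE.of_le hFE)]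
  exact hMu_le_hMuMax (posDef_baseChangeMetric K' hH) (baseChange_fg K' hE)
    (baseChange_ne_bot K' hF) (baseChange_mono K' hFE)

end Slopes

section Descent

variable {K L ι : Type} [Field K] [Field L] [Algebra K L]

theorem le_span_coordMap_of_forall_algEquiv [FiniteDimensional K L] [IsGalois K L]
    {W : Submodule L (ι → L)} (hW : ∀ g : L ≃ₐ[K] L, ∀ w ∈ W, (fun i => g (w i)) ∈ W) :
    W ≤ Submodule.span L (coordMap K L '' {v | coordMap K L v ∈ W}) := by
  intro w hw
  let b := Module.finBasis K L
  let v := fun j i => Algebra.trace K L (w i * b j)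
  have hv : ∀ j, coordMap K L (v j) ∈ W := fun j => by
    have h : coordMap K L (v j) = ∑ g : L ≃ₐ[K] L, g (b j) • fun i => g (w i) := by
      ext i
      simp [v, trace_eq_sum_automorphisms, mul_comm]
    rw [h]
    exact W.sum_mem fun g _ => W.smul_mem _ (hW g w hw)
  have h : w = ∑ j, b.traceDual j • coordMap K L (v j) := by
    ext i
    conv_lhs => rw [← b.traceDual.sum_repr (w i)]
    simp [v, Algebra.smul_def, mul_comm, Module.Basis.traceDual_repr_apply]
  rw [h]
  exact Submodule.sum_mem _ fun j _ =>
    Submodule.smul_mem _ _ (Submodule.subset_span ⟨v j, hv j, rfl⟩)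

theorem exists_linearMap_coordMap [Fintype ι] (f : (ι → K) →ₗ[K] (ι → K)) :
    ∃ f' : (ι → L) →ₗ[L] (ι → L), ∀ v, f' (coordMap K L v) = coordMap K L (f v) := by
  refine ⟨Matrix.toLin' ((LinearMap.toMatrix' f).map (algebraMap K L)), fun v => ?_⟩
  ext i
  rw [coordMap_apply, ← LinearMap.toMatrix'_mulVec f, RingHom.map_mulVec]
  rfl

variable [NumberField K] [NumberField L] [Fintype ι]

theorem exists_linearMap_extend {E : Submodule (𝓞 K) (ι → K)} (f : E →ₗ[𝓞 K] (ι → K)) :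
    ∃ g : (ι → K) →ₗ[K] (ι → K), ∀ e : E, g e = f e := by
  obtain ⟨x, hx⟩ := exists_isFrame E
  obtain ⟨g, hg⟩ := LinearMap.exists_extend
    ((Module.Basis.span hx.linearIndependent).constr ℕ fun a => f ⟨x a, hx.mem a⟩)
  have hgx : ∀ a, g (x a) = f ⟨x a, hx.mem a⟩ := fun a => by
    have h := LinearMap.congr_fun hg (Module.Basis.span hx.linearIndependent a)
    rw [Module.Basis.constr_basis] at h
    rw [← h, LinearMap.comp_apply, Submodule.subtype_apply, Module.Basis.span_apply]
  refine ⟨g, fun e => ?_⟩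
  obtain ⟨n, hn, h⟩ := hx.exists_int_smul_mem_span e.2
  obtain ⟨c, hc⟩ := (Submodule.mem_span_range_iff_exists_fun (𝓞 K)).mp h
  have hc' : ∑ a, c a • (⟨x a, hx.mem a⟩ : E) = n • e := by
    ext1
    simpa using hc
  refine smul_right_injective _ hn ?_
  change n • g e = n • f e
  rw [← map_zsmul, ← map_zsmul, ← hc', ← hc, map_sum, map_sum]
  refine Finset.sum_congr rfl fun a _ => ?_
  rw [f.map_smul, ← hgx]
  exact g.map_smul (c a : K) (x a)

theorem exists_retraction {E : Submodule (𝓞 K) (ι → K)} (hE : E.FG)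
    (V : Submodule K (ι → K)) :
    ∃ f : (ι → K) →ₗ[K] (ι → K), (∀ e ∈ E, f e ∈ E ⊓ V.restrictScalars (𝓞 K)) ∧
      ∀ v ∈ E ⊓ V.restrictScalars (𝓞 K), f v = v := by
  have : Module.Finite (𝓞 K) E := Module.Finite.iff_fg.mpr hE
  set N := (V.restrictScalars (𝓞 K)).comap E.subtype
  have htf : Module.IsTorsionFree (𝓞 K) (E ⧸ N) := by
    refine .of_smul_eq_zero fun c q hq => ?_
    obtain ⟨e, rfl⟩ := N.mkQ_surjective q
    change N.mkQ (c • e) = 0 at hq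
    rw [N.mkQ_apply, Submodule.Quotient.mk_eq_zero] at hq
    refine or_iff_not_imp_left.mpr fun hc => (Submodule.Quotient.mk_eq_zero N).mpr ?_
    have hq' : (c : K) • (e : ι → K) ∈ V := hq
    exact (V.smul_mem_iff (by simpa using hc)).mp hq'
  have : Module.Projective (𝓞 K) (E ⧸ N) := by
    have := Module.finitePresentation_of_finite (𝓞 K) (E ⧸ N)
    exact Module.Flat.projective_of_finitePresentation
  obtain ⟨s, hs⟩ := Module.projective_lifting_property N.mkQ LinearMap.id N.mkQ_surjective
  obtain ⟨f, hf⟩ := exists_linearMap_extend (E.subtype ∘ₗ (LinearMap.id - s ∘ₗ N.mkQ))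
  have hf' : ∀ e : E, f e = ((e - s (N.mkQ e) : E) : ι → K) := hf
  refine ⟨f, fun e he => ?_, fun v hv => ?_⟩
  · rw [hf' ⟨e, he⟩]
    have h : ⟨e, he⟩ - s (N.mkQ ⟨e, he⟩) ∈ N := by
      refine (Submodule.Quotient.mk_eq_zero N).mp ?_
      change N.mkQ _ = 0
      rw [map_sub, sub_eq_zero]
      exact (LinearMap.congr_fun hs _).symm
    exact ⟨Subtype.property _, h⟩
  · have h : N.mkQ ⟨v, hv.1⟩ = 0 := (Submodule.Quotient.mk_eq_zero N).mpr hv.2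
    rw [hf' ⟨v, hv.1⟩, h, map_zero, sub_zero]

theorem baseChange_inf_span_le {E : Submodule (𝓞 K) (ι → K)} (hE : E.FG)
    (hfull : Submodule.span K (E : Set (ι → K)) = ⊤) (V : Submodule K (ι → K)) :
    baseChange K L E ⊓ (Submodule.span L (coordMap K L '' V)).restrictScalars (𝓞 L) ≤
      baseChange K L (E ⊓ V.restrictScalars (𝓞 K)) := by
  obtain ⟨f, hf, hfid⟩ := exists_retraction hE V
  obtain ⟨f', hf'⟩ := exists_linearMap_coordMap (L := L) f
  rintro w ⟨hw, hwV⟩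
  have hV : ∀ v ∈ V, f v = v := fun v hv => by
    obtain ⟨n, hn, h⟩ := NumberField.exists_int_smul_mem_of_mem_span
      (hfull ▸ Submodule.mem_top : v ∈ Submodule.span K (E : Set (ι → K)))
    refine smul_right_injective _ hn ?_
    change n • f v = n • v
    rw [← map_zsmul]
    exact hfid _ ⟨h, zsmul_mem hv n⟩
  have hid : f' w = w := LinearMap.eqOn_span (g := LinearMap.id)
    (by rintro _ ⟨v, hv, rfl⟩; simp [hf', hV v hv]) hwV
  rw [← hid]
  have hle : baseChange K L E ≤
      (baseChange K L (E ⊓ V.restrictScalars (𝓞 K))).comap (f'.restrictScalars (𝓞 L)) := by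
    refine Submodule.span_le.mpr ?_
    rintro _ ⟨v, hv, rfl⟩
    change f' (coordMap K L v) ∈ baseChange K L _
    rw [hf']
    exact coordMap_mem_baseChange L (hf v hv)
  exact hle hw

theorem exists_baseChange_of_forall_algEquiv [IsGalois K L] {E : Submodule (𝓞 K) (ι → K)}
    (hE : E.FG) (hfull : Submodule.span K (E : Set (ι → K)) = ⊤) {M : Submodule (𝓞 L) (ι → L)}
    (hM : M ≤ baseChange K L E) (hg : ∀ g : L ≃ₐ[K] L, ∀ v ∈ M, (fun i => g (v i)) ∈ M) :
    ∃ F ≤ E, M ≤ baseChange K L F ∧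
      Submodule.span L (M : Set (ι → L)) = Submodule.span L (baseChange K L F : Set (ι → L)) := by
  set W := Submodule.span L (M : Set (ι → L))
  have hW : ∀ g : L ≃ₐ[K] L, ∀ w ∈ W, (fun i => g (w i)) ∈ W := fun g w hw => by
    induction hw using Submodule.span_induction with
    | mem v hv => exact Submodule.subset_span (hg g v hv)
    | zero => simp [← Pi.zero_def]
    | add u v _ _ hu hv => simpa [Pi.add_def] using W.add_mem hu hv
    | smul c v _ hv => simpa [Pi.smul_def] using W.smul_mem (g c) hv
  let V : Submodule K (ι → K) := (W.restrictScalars K).comap (coordMap K L)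
  have hWV := le_span_coordMap_of_forall_algEquiv hW
  have hMF : M ≤ baseChange K L (E ⊓ V.restrictScalars (𝓞 K)) := fun w hw =>
    baseChange_inf_span_le hE hfull V ⟨hM hw, hWV (Submodule.subset_span hw)⟩
  refine ⟨_, inf_le_left, hMF, le_antisymm (Submodule.span_mono hMF) (Submodule.span_le.mpr ?_)⟩
  refine (Submodule.span_le (p := W.restrictScalars (𝓞 L))).mpr ?_
  rintro _ ⟨v, hv, rfl⟩
  exact hv.2

end Descent

section GaloisDescent

variable {K ι : Type} [Field K] [NumberField K] [Fintype ι] {H : (K →+* ℂ) → Matrix ι ι ℂ}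

theorem hMuMax_mul_hRank_sub_hDeg_sup_le (hH : ∀ σ, (H σ).PosDef)
    {P F G : Submodule (𝓞 K) (ι → K)} (hP : P.FG) (hF : F ≤ P) (hG : G ≤ P) :
    hMuMax K H P * hRank K (F ⊔ G) - hDeg K H (F ⊔ G) ≤
      (hMuMax K H P * hRank K F - hDeg K H F) + (hMuMax K H P * hRank K G - hDeg K H G) := by
  have h1 := hDeg_add_hDeg_le hH (hP.of_le hF) (hP.of_le hG)
  have h2 := hDeg_le_hMuMax_mul hH hP (inf_le_of_left_le hF : F ⊓ G ≤ P)
  have h3 : (hRank K (F ⊔ G) + hRank K (F ⊓ G) : ℝ) = hRank K F + hRank K G := by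
    exact_mod_cast hRank_sup_add_hRank_inf F G
  linear_combination h1 + h2 + hMuMax K H P * h3

theorem hMuMax_mul_hRank_sub_hDeg_finsetSup_le (hH : ∀ σ, (H σ).PosDef) {α : Type}
    {P : Submodule (𝓞 K) (ι → K)} (hP : P.FG) {F : α → Submodule (𝓞 K) (ι → K)}
    (hF : ∀ a, F a ≤ P) (S : Finset α) :
    hMuMax K H P * hRank K (S.sup F) - hDeg K H (S.sup F) ≤
      ∑ a ∈ S, (hMuMax K H P * hRank K (F a) - hDeg K H (F a)) := by
  induction S using Finset.induction_on with
  | empty => simp [hRank_bot, hDeg_bot hH]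
  | insert a S ha ih =>
    rw [Finset.sup_insert, Finset.sum_insert ha]
    have := hMuMax_mul_hRank_sub_hDeg_sup_le hH hP (hF a) (Finset.sup_le fun b _ => hF b :
      S.sup F ≤ P)
    linarith

variable {L : Type} [Field L] [NumberField L] [Algebra K L]

theorem conjSubmodule_le_baseChange (g : L ≃ₐ[K] L) {E : Submodule (𝓞 K) (ι → K)}
    {F : Submodule (𝓞 L) (ι → L)} (hF : F ≤ baseChange K L E) :
    conjSubmodule g F ≤ baseChange K L E := by
  refine (conjSubmodule_le_iff g).mpr fun v hv => ?_
  replace hv := hF hv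
  rw [baseChange_eq_span] at hv
  let _ : Algebra L L := (g : L →+* L).toAlgebra
  have key : baseChange L L (baseChange K L E) ≤ baseChange K L E := by
    rw [baseChange_eq_span K L, baseChange_span]
    refine Submodule.span_mono ?_
    rintro _ ⟨_, ⟨v, hv, rfl⟩, rfl⟩
    refine ⟨v, hv, ?_⟩
    ext i
    exact (g.commutes (v i)).symm
  exact key (coordMap_mem_baseChange L hv)

theorem hDeg_le_of_forall_algEquiv [IsGalois K L] (hH : ∀ σ, (H σ).PosDef)
    {E : Submodule (𝓞 K) (ι → K)} (hE : E.FG)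
    (hfull : Submodule.span K (E : Set (ι → K)) = ⊤) {M : Submodule (𝓞 L) (ι → L)}
    (hM : M ≤ baseChange K L E) (hg : ∀ g : L ≃ₐ[K] L, ∀ v ∈ M, (fun i => g (v i)) ∈ M) :
    hDeg L (baseChangeMetric K L H) M ≤ Module.finrank K L * hMuMax K H E * hRank L M := by
  obtain ⟨F, hFE, hMF, hs⟩ := exists_baseChange_of_forall_algEquiv hE hfull hM hg
  have hF := hE.of_le hFE
  have h1 := hDeg_le_hDeg_of_span_eq (posDef_baseChangeMetric L hH) (baseChange_fg L hF) hMF hs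
  have h2 := hDeg_le_hMuMax_mul hH hE hFE
  have h3 : hRank L M = hRank K F := by rw [← hRank_baseChange L F, hRank, hs, hRank]
  rw [hDeg_baseChange L hH hF] at h1
  rw [h3, mul_assoc]
  exact h1.trans (by gcongr)

theorem hMuMax_baseChange_le_of_isGalois [IsGalois K L] (hH : ∀ σ, (H σ).PosDef)
    {E : Submodule (𝓞 K) (ι → K)} (hE : E.FG) (hE0 : E ≠ ⊥)
    (hfull : Submodule.span K (E : Set (ι → K)) = ⊤) :
    hMuMax L (baseChangeMetric K L H) (baseChange K L E) ≤
      Module.finrank K L * hMuMax K H E := by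
  by_contra! hlt
  set s := hMuMax L (baseChangeMetric K L H) (baseChange K L E)
  set t := Module.finrank K L * hMuMax K H E
  have hH' := posDef_baseChangeMetric L hH
  have hP := baseChange_fg L hE
  have hP0 := baseChange_ne_bot L hE0
  set N : ℝ := (Fintype.card (L ≃ₐ[K] L) : ℝ)
  set n : ℝ := (hRank L (baseChange K L E) : ℝ)
  have hN : 0 < N := Nat.cast_pos.mpr Fintype.card_pos
  have hn : 0 < n := Nat.cast_pos.mpr (hRank_pos hP0)
  have hgap : 0 < (s - t) / (N * n) := by have := sub_pos.mpr hlt; positivity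
  suffices s ≤ s - (s - t) / (N * n) by linarith
  refine hMuMax_le hP0 fun F hF hFP => ?_
  set M := Finset.univ.sup fun g : L ≃ₐ[K] L => conjSubmodule g F
  have hgP : ∀ g : L ≃ₐ[K] L, conjSubmodule g F ≤ baseChange K L E := fun g =>
    conjSubmodule_le_baseChange g hFP
  have hMP : M ≤ baseChange K L E := Finset.sup_le fun g _ => hgP g
  have hgM : ∀ g : L ≃ₐ[K] L, conjSubmodule g F ≤ M := fun g =>
    Finset.le_sup (f := fun g : L ≃ₐ[K] L => conjSubmodule g F) (Finset.mem_univ g)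
  have hFM : F ≤ M := (conjSubmodule_one (K := K) F).ge.trans (hgM 1)
  have hst : ∀ g : L ≃ₐ[K] L, ∀ v ∈ M, (fun i => g (v i)) ∈ M := by
    have hle : ∀ g : L ≃ₐ[K] L, M ≤ conjSubmodule g⁻¹ M := fun g => Finset.sup_le fun h _ =>
      (conjSubmodule_le_iff h).mpr fun v hv => by
        simpa using mem_conjSubmodule g⁻¹ (hgM (g * h) (mem_conjSubmodule (g * h) hv))
    intro g v hv
    have h := apply_mem_conjSubmodule_mul g g⁻¹ (hle g hv)
    rwa [mul_inv_cancel, conjSubmodule_one] at h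
  have h1 := hMuMax_mul_hRank_sub_hDeg_finsetSup_le hH' hP hgP Finset.univ
  simp only [hRank_conjSubmodule, hDeg_conjSubmodule hH _ (hP.of_le hFP), Finset.sum_const,
    Finset.card_univ, nsmul_eq_mul] at h1
  have h2 := hDeg_le_of_forall_algEquiv hH hE hfull hMP hst
  have hFr : (1 : ℝ) ≤ hRank L F := by exact_mod_cast hRank_pos hF
  have hMr : (hRank L F : ℝ) ≤ hRank L M := by exact_mod_cast hRank_mono hFM
  have hFn : (hRank L F : ℝ) ≤ n := Nat.cast_le.mpr (hRank_mono hFP)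
  have h3 : s - t ≤ N * (s * hRank L F - hDeg L (baseChangeMetric K L H) F) := by
    refine le_trans ?_ h1
    nlinarith
  have h4 : (s - t) / N ≤ s * hRank L F - hDeg L (baseChangeMetric K L H) F :=
    (div_le_iff₀' hN).mpr h3
  rw [hMu, div_le_iff₀ (by linarith), sub_mul, ← div_div]
  have h5 : (s - t) / N / n * hRank L F ≤ (s - t) / N := by
    rw [div_mul_eq_mul_div, div_le_iff₀ hn]
    exact mul_le_mul_of_nonneg_left hFn (by have := sub_pos.mpr hlt; positivity)
  linarith

end GaloisDescent

end

/-- Let `K` be a number field, `Ē` a nonzero hermitian `𝒪_K`-lattice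
(a finitely generated full `𝒪_K`-lattice in `K^ι`, `ι ≠ ∅`, with positive definite
conjugation-compatible metrics `H`), and `K'/K` a finite extension of degree `d`.
Then `μ_max(Ē ⊗_{𝒪_K} 𝒪_{K'}) = d · μ_max(Ē)` (scalar-extended metrics). -/
theorem hMuMax_baseChange (K K' : Type) [Field K] [NumberField K] [Field K'] [NumberField K']
    [Algebra K K'] {ι : Type} [Fintype ι] [Nonempty ι]
    (E : Submodule (𝓞 K) (ι → K)) (hfg : E.FG)
    (hfull : Submodule.span K ((E : Set (ι → K))) = ⊤)
    (H : (K →+* ℂ) → Matrix ι ι ℂ)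
    (hpos : ∀ σ, (H σ).PosDef) (hconj : ConjCompatible K H) :
    hMuMax K' (baseChangeMetric K K' H) (baseChange K K' E) =
      (Module.finrank K K' : ℝ) * hMuMax K H E := by
  have hE0 : E ≠ ⊥ := fun h => by simp [h] at hfull
  refine le_antisymm ?_ (mul_hMuMax_le_hMuMax_baseChange K' hpos hfg hE0)
  let L := IntermediateField.normalClosure K K' (AlgebraicClosure K')
  have : Normal K L := inferInstance
  have : NumberField L := NumberField.of_module_finite K L
  have : IsGalois K L := ⟨⟩
  have hd : (0 : ℝ) < Module.finrank K' L := by exact_mod_cast Module.finrank_pos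
  have h1 := mul_hMuMax_le_hMuMax_baseChange L (posDef_baseChangeMetric K' hpos)
    (baseChange_fg K' hfg) (baseChange_ne_bot K' hE0)
  rw [baseChangeMetric_baseChangeMetric, baseChange_baseChange] at h1
  have h2 := h1.trans (hMuMax_baseChange_le_of_isGalois hpos hfg hE0 hfull)
  rw [← Module.finrank_mul_finrank K K' L, Nat.cast_mul, mul_comm (Module.finrank K K' : ℝ),
    mul_assoc] at h2
  exact le_of_mul_le_mul_left h2 hd
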